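/- arXiv:1111.1020 — 3 statements merged into one kernel-verified Lean document; each statement's English description precedes it below -/
import Mathlib

section
/- For any tree-structured pairwise Markov random field, let {m^t} be the message sequence generated by the SBP algorithm with step size α_t = 1/(t+1), and let m* be the unique BP fixed point. Then there exists a matrix A∈ℝ^{D×D} with nonnegative entries which is nilpotent of degree at most r = diam(G) (i.e., A^r = 0, where diam(G) is the diameter of G), such that for all iterations t = 1, 2, …, the expected absolute error satisfies the elementwise inequality E[|m^t − m*|] ⪯ 4 (I − 2A)^{−1} (1/√t) 𝟏, where |·| is the elementwise absolute value, 𝟏∈ℝ^D is the all-ones vector, and ⪯ denotes coordinatewise inequality. -/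
open Finset MeasureTheory Filter

noncomputable def l2norm {ι : Type*} [Fintype ι] (x : ι → ℝ) : ℝ :=
  Real.sqrt (∑ i, x i ^ 2)

structure GM (V : Type*) [Fintype V] [DecidableEq V] where
  G : SimpleGraph V
  adjDec : DecidableRel G.Adj
  d : ℕ
  ψn : V → Fin d → ℝ
  ψe : V → V → Fin d → Fin d → ℝ

attribute [instance] GM.adjDec

namespace GM

variable {V : Type*} [Fintype V] [DecidableEq V] (P : GM V)

abbrev DirEdge : Type _ := {e : V × V // P.G.Adj e.1 e.2}

abbrev Msg : Type _ := P.DirEdge × Fin P.d → ℝ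

noncomputable def bmass (e : P.DirEdge) (j : Fin P.d) : ℝ :=
  P.ψn e.1.1 j * ∑ i, P.ψe e.1.1 e.1.2 i j

noncomputable def Gam (e : P.DirEdge) (i j : Fin P.d) : ℝ :=
  P.ψe e.1.1 e.1.2 i j * P.ψn e.1.1 j / P.bmass e j

def revEdge (e : P.DirEdge) (w : {x // x ∈ (P.G.neighborFinset e.1.1).erase e.1.2}) :
    P.DirEdge :=
  ⟨(w.1, e.1.1), by
    have h := Finset.mem_of_mem_erase w.2
    rw [SimpleGraph.mem_neighborFinset] at h
    exact h.symm⟩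

noncomputable def Mprod (m : P.Msg) (e : P.DirEdge) (j : Fin P.d) : ℝ :=
  ∏ w ∈ ((P.G.neighborFinset e.1.1).erase e.1.2).attach, m (P.revEdge e w, j)

noncomputable def bp (m : P.Msg) : P.Msg := fun p =>
  (∑ j, P.ψe p.1.1.1 p.1.1.2 p.2 j * P.ψn p.1.1.1 j * P.Mprod m p.1 j) /
  (∑ i, ∑ j, P.ψe p.1.1.1 p.1.1.2 i j * P.ψn p.1.1.1 j * P.Mprod m p.1 j)

noncomputable def beta0 (e : P.DirEdge) (i : Fin P.d) : ℝ := ⨅ j, P.Gam e i j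

noncomputable def mu0 (e : P.DirEdge) (i : Fin P.d) : ℝ := ⨆ j, P.Gam e i j

def ball : Set P.Msg :=
  {m | ∀ e : P.DirEdge, (∑ i, m (e, i)) = 1 ∧
    ∀ i, P.beta0 e i ≤ m (e, i) ∧ m (e, i) ≤ P.mu0 e i}

noncomputable def Cpsi : ℝ :=
  4 * (∑ e : P.DirEdge, ⨆ i, P.mu0 e i) / (∑ e : P.DirEdge, ⨅ i, P.beta0 e i)

noncomputable def sbpProb (m : P.Msg) (e : P.DirEdge) (j : Fin P.d) : ℝ :=
  P.bmass e j * P.Mprod m e j / ∑ k, P.bmass e k * P.Mprod m e k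

noncomputable def graphDiam : ℕ :=
  Finset.univ.sup fun pr : V × V => P.G.dist pr.1 pr.2

def IsSBP {Ω : Type*} {mΩ : MeasurableSpace Ω} (μ : Measure Ω)
    (ℱ : Filtration ℕ mΩ) (α : ℕ → ℝ) (m0 : P.Msg)
    (M : ℕ → Ω → P.Msg) (J : ℕ → Ω → P.DirEdge → Fin P.d) : Prop :=
  (∀ ω, M 0 ω = m0) ∧
  (∀ t, Measurable[ℱ t] (M t)) ∧
  (∀ t, Measurable[ℱ (t+1)] (J (t+1))) ∧
  (∀ t ω (e : P.DirEdge) (i : Fin P.d),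
      M (t+1) ω (e, i) = (1 - α t) * M t ω (e, i) + α t * P.Gam e i (J (t+1) ω e)) ∧
  (∀ t (jj : P.DirEdge → Fin P.d),
      (μ[(fun ω => if ∀ e, J (t+1) ω e = jj e then (1:ℝ) else 0) | ℱ t])
        =ᵐ[μ] fun ω => ∏ e : P.DirEdge, P.sbpProb (M t ω) e (jj e))

end GM

namespace SBPaux

variable {V : Type*} [Fintype V] [DecidableEq V] (P : GM V)

lemma prod_lip {ι : Type*} [DecidableEq ι] (s : Finset ι) (f g : ι → ℝ)
    (hf : ∀ i, 0 ≤ f i ∧ f i ≤ 1) (hg : ∀ i, 0 ≤ g i ∧ g i ≤ 1) :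
    |∏ i ∈ s, f i - ∏ i ∈ s, g i| ≤ ∑ i ∈ s, |f i - g i| := by
  induction s using Finset.induction_on with
  | empty => simp
  | insert a s ha ih =>
    rw [Finset.prod_insert ha, Finset.prod_insert ha, Finset.sum_insert ha]
    have h1 : f a * ∏ i ∈ s, f i - g a * ∏ i ∈ s, g i
        = (f a - g a) * ∏ i ∈ s, f i + g a * (∏ i ∈ s, f i - ∏ i ∈ s, g i) := by ring
    rw [h1]
    refine (abs_add_le _ _).trans ?_
    have hp0 : 0 ≤ ∏ i ∈ s, f i := Finset.prod_nonneg fun i _ => (hf i).1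
    have hp1 : ∏ i ∈ s, f i ≤ 1 := Finset.prod_le_one (fun i _ => (hf i).1) fun i _ => (hf i).2
    rw [abs_mul, abs_mul, abs_of_nonneg hp0, abs_of_nonneg (hg a).1]
    have := mul_le_of_le_one_right (abs_nonneg (f a - g a)) hp1
    have := mul_le_of_le_one_left (abs_nonneg (∏ i ∈ s, f i - ∏ i ∈ s, g i)) (hg a).2
    linarith

lemma ratio_lip {a s a' s' D : ℝ} (hs : 0 < s) (hs' : 0 < s') (ha : 0 ≤ a) (has : a ≤ s)
    (h1 : |a - a'| ≤ D) (h2 : |s - s'| ≤ D) : |a / s - a' / s'| ≤ 2 * D / s' := by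
  have e : a / s - a' / s' = ((a / s) * (s' - s) + (a - a')) / s' := by
    field_simp; ring
  rw [e, abs_div, abs_of_pos hs']
  refine div_le_div_of_nonneg_right ?_ hs'.le
  refine (abs_add_le _ _).trans ?_
  have h3 : 0 ≤ a / s := by positivity
  have h4 : a / s ≤ 1 := (div_le_one hs).2 has
  rw [abs_mul, abs_of_nonneg h3, abs_sub_comm s' s]
  have := mul_le_of_le_one_left (abs_nonneg (s - s')) h4
  linarith

noncomputable def Sden (m : P.Msg) (e : P.DirEdge) : ℝ := ∑ k, P.bmass e k * P.Mprod m e k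

noncomputable def Amat (ms : P.Msg) :
    Matrix (P.DirEdge × Fin P.d) (P.DirEdge × Fin P.d) ℝ := fun p q =>
  (2 * P.bmass p.1 q.2 / Sden P ms p.1) *
    ∑ w ∈ ((P.G.neighborFinset p.1.1.1).erase p.1.1.2).attach,
      if P.revEdge p.1 w = q.1 then 1 else 0

lemma Amat_mulVec (ms : P.Msg) (x : P.Msg) (p : P.DirEdge × Fin P.d) :
    ∑ q, Amat P ms p q * x q = 2 * (∑ k, P.bmass p.1 k *
      ∑ w ∈ ((P.G.neighborFinset p.1.1.1).erase p.1.1.2).attach, x (P.revEdge p.1 w, k))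
      / Sden P ms p.1 := by
  rw [Fintype.sum_prod_type_right, Finset.mul_sum, Finset.sum_div]
  refine Finset.sum_congr rfl fun k _ => ?_
  simp only [Amat, mul_assoc, Finset.sum_mul]
  rw [← Finset.mul_sum, Finset.sum_comm]
  simp
  ring

lemma Amat_walk (htree : P.G.IsTree) (ms : P.Msg) (n : ℕ) :
    ∀ p q, (Amat P ms ^ n) p q ≠ 0 →
      ∃ W : P.G.Walk p.1.1.2 q.1.1.1, W.IsPath ∧ W.length = n + 1 ∧ W.snd = p.1.1.1 := by
  induction n with
  | zero =>
    intro p q h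
    rw [pow_zero, Matrix.one_apply] at h
    have hpq : p = q := by by_contra hc; simp [hc] at h
    subst hpq
    exact ⟨SimpleGraph.Walk.cons p.1.2.symm SimpleGraph.Walk.nil,
      by simp [p.1.2.ne'], by simp, by simp⟩
  | succ n ih =>
    intro p q h
    rw [pow_succ', Matrix.mul_apply] at h
    obtain ⟨x, -, hx⟩ := Finset.exists_ne_zero_of_sum_ne_zero h
    have h1 : Amat P ms p x ≠ 0 := left_ne_zero_of_mul hx
    have h2 := right_ne_zero_of_mul hx
    obtain ⟨W, hW, hl, hs⟩ := ih x q h2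
    obtain ⟨w, -, hw⟩ := Finset.exists_ne_zero_of_sum_ne_zero (right_ne_zero_of_mul h1)
    have hw' : P.revEdge p.1 w = x.1 := by by_contra hc; simp [hc] at hw
    have e1 : x.1.1.1 = w.1 := by rw [← hw']; rfl
    have e2 : x.1.1.2 = p.1.1.1 := by rw [← hw']; rfl
    have hne : w.1 ≠ p.1.1.2 := (Finset.mem_erase.1 w.2).1
    have hadj : P.G.Adj p.1.1.2 x.1.1.2 := by rw [e2]; exact p.1.2.symm
    refine ⟨SimpleGraph.Walk.cons hadj W, ?_, by simp [hl], by simp [e2]⟩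
    rw [SimpleGraph.Walk.cons_isPath_iff]
    refine ⟨hW, fun hmem => hne ?_⟩
    have := htree.isAcyclic.eq_snd_of_adj_start hW hadj.symm hmem
    exact (this.trans (hs.trans e1)).symm

lemma Amat_nil (htree : P.G.IsTree) (ms : P.Msg) : Amat P ms ^ P.graphDiam = 0 := by
  ext p q
  by_contra h
  obtain ⟨W, hW, hl, -⟩ := Amat_walk P htree ms _ p q h
  obtain ⟨W', hW', hl'⟩ := htree.connected.exists_path_of_dist p.1.1.2 q.1.1.1
  have : W = W' := (htree.existsUnique_path _ _).unique hW hW'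
  subst this
  have : P.G.dist p.1.1.2 q.1.1.1 ≤ P.graphDiam :=
    Finset.le_sup (f := fun pr : V × V => P.G.dist pr.1 pr.2) (Finset.mem_univ (p.1.1.2, q.1.1.1))
  omega

/-- Entries of a nonnegative nilpotent resolvent. -/
lemma resolvent {ι : Type*} [Fintype ι] [DecidableEq ι] (A : Matrix ι ι ℝ)
    (hA : ∀ p q, 0 ≤ A p q) (r : ℕ) (hr : A ^ r = 0) (c : ℝ) (hc : 0 ≤ c) :
    (∀ p, 0 ≤ ((1 - (2 : ℝ) • A)⁻¹.mulVec (fun _ => c)) p) ∧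
    ∀ p, ((1 - (2 : ℝ) • A)⁻¹.mulVec (fun _ => c)) p = c +
      2 * ∑ q, A p q * ((1 - (2 : ℝ) • A)⁻¹.mulVec (fun _ => c)) q := by
  have hg : (1 - (2 : ℝ) • A) * ∑ i ∈ range r, ((2 : ℝ) • A) ^ i = 1 := by
    rw [mul_neg_geom_sum, smul_pow, hr]; simp
  have hinv := Matrix.inv_eq_right_inv hg
  have hpow : ∀ n p q, 0 ≤ (((2 : ℝ) • A) ^ n) p q := by
    intro n
    induction n with
    | zero => intro p q; rw [pow_zero, Matrix.one_apply]; split_ifs <;> norm_num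
    | succ n ih =>
      intro p q
      rw [pow_succ, Matrix.mul_apply]
      refine Finset.sum_nonneg fun x _ => mul_nonneg (ih _ _) ?_
      simpa using hA x q
  refine ⟨fun p => ?_, fun p => ?_⟩
  · rw [hinv]
    refine Finset.sum_nonneg fun q _ => mul_nonneg ?_ hc
    change 0 ≤ (∑ i ∈ range r, ((2 : ℝ) • A) ^ i) p q
    rw [Matrix.sum_apply]
    exact Finset.sum_nonneg fun i _ => hpow i p q
  · have h : (1 - (2 : ℝ) • A).mulVec ((1 - (2 : ℝ) • A)⁻¹.mulVec (fun _ => c)) = fun _ => c := by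
      rw [Matrix.mulVec_mulVec, hinv, hg, Matrix.one_mulVec]
    have h' := congrFun h p
    rw [Matrix.sub_mulVec, Matrix.one_mulVec, Matrix.smul_mulVec] at h'
    simp only [Pi.sub_apply, Pi.smul_apply, smul_eq_mul] at h'
    have : (A.mulVec ((1 - (2 : ℝ) • A)⁻¹.mulVec (fun _ => c))) p =
      ∑ q, A p q * ((1 - (2 : ℝ) • A)⁻¹.mulVec (fun _ => c)) q := rfl
    linarith

lemma sum_inv_sqrt' (n : ℕ) :
    ∑ s ∈ Finset.range n, 1 / Real.sqrt ((s + 1 : ℕ) : ℝ) ≤ 2 * Real.sqrt n := by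
  induction n with
  | zero => simp
  | succ n ih =>
    rw [Finset.sum_range_succ]
    have hb : 0 < Real.sqrt ((n + 1 : ℕ) : ℝ) := Real.sqrt_pos.2 (by positivity)
    have hb2 : Real.sqrt ((n + 1 : ℕ) : ℝ) ^ 2 = n + 1 := by
      rw [Real.sq_sqrt (by positivity)]; push_cast; ring
    have ha2 : Real.sqrt (n : ℝ) ^ 2 = n := Real.sq_sqrt (by positivity)
    have : 1 / Real.sqrt ((n + 1 : ℕ) : ℝ) ≤
        2 * Real.sqrt ((n + 1 : ℕ) : ℝ) - 2 * Real.sqrt n := by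
      rw [div_le_iff₀ hb]
      nlinarith [sq_nonneg (Real.sqrt ((n + 1 : ℕ) : ℝ) - Real.sqrt n)]
    linarith

lemma sum_inv_sqrt (t : ℕ) : ∑ s ∈ Finset.Ico 1 t, 1 / Real.sqrt s ≤ 2 * Real.sqrt t := by
  rw [Finset.sum_Ico_eq_sum_range]
  have := sum_inv_sqrt' (t - 1)
  have h2 : Real.sqrt ((t - 1 : ℕ) : ℝ) ≤ Real.sqrt t :=
    Real.sqrt_le_sqrt (by exact_mod_cast Nat.sub_le t 1)
  simp only [add_comm 1]
  linarith

section pos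
variable (hψn : ∀ u j, 0 < P.ψn u j) (hψe : ∀ u v i j, 0 < P.ψe u v i j)

lemma Mprod_pos (m : P.Msg) (hm : ∀ p, 0 < m p) (e : P.DirEdge) (j : Fin P.d) :
    0 < P.Mprod m e j := Finset.prod_pos fun _ _ => hm _

include hψn hψe

lemma bmass_pos (e : P.DirEdge) (j : Fin P.d) : 0 < P.bmass e j :=
  mul_pos (hψn _ _) (Finset.sum_pos (fun _ _ => hψe _ _ _ _) ⟨j, Finset.mem_univ j⟩)

lemma Gam_pos (e : P.DirEdge) (i j : Fin P.d) : 0 < P.Gam e i j :=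
  div_pos (mul_pos (hψe _ _ _ _) (hψn _ _)) (bmass_pos P hψn hψe e j)

lemma Gam_sum (e : P.DirEdge) (j : Fin P.d) : ∑ i, P.Gam e i j = 1 := by
  have h := bmass_pos P hψn hψe e j
  simp only [GM.Gam]
  rw [← Finset.sum_div, ← Finset.sum_mul, mul_comm]
  exact div_self h.ne'

lemma Gam_le (e : P.DirEdge) (i j : Fin P.d) : P.Gam e i j ≤ 1 := by
  rw [← Gam_sum P hψn hψe e j]
  exact Finset.single_le_sum (f := fun i => P.Gam e i j)
    (fun i _ => (Gam_pos P hψn hψe e i j).le) (Finset.mem_univ i)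

lemma Sden_pos (hd : 0 < P.d) (m : P.Msg) (hm : ∀ p, 0 < m p) (e : P.DirEdge) :
    0 < Sden P m e :=
  Finset.sum_pos (fun k _ => mul_pos (bmass_pos P hψn hψe e k) (Mprod_pos P m hm e k))
    ⟨⟨0, hd⟩, Finset.mem_univ _⟩

lemma Gam_bmass (e : P.DirEdge) (i j : Fin P.d) :
    P.Gam e i j * P.bmass e j = P.ψe e.1.1 e.1.2 i j * P.ψn e.1.1 j :=
  div_mul_cancel₀ _ (bmass_pos P hψn hψe e j).ne'

lemma bp_eq (m : P.Msg) (p : P.DirEdge × Fin P.d) :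
    P.bp m p = (∑ j, P.Gam p.1 p.2 j * (P.bmass p.1 j * P.Mprod m p.1 j)) / Sden P m p.1 := by
  simp only [GM.bp, Sden]
  congr 1
  · refine Finset.sum_congr rfl fun j _ => ?_
    rw [← mul_assoc, Gam_bmass P hψn hψe]
  · rw [Finset.sum_comm]
    refine Finset.sum_congr rfl fun j _ => ?_
    rw [← Finset.sum_mul, ← Finset.sum_mul, GM.bmass]
    ring

lemma bp_eq' (m : P.Msg) (p : P.DirEdge × Fin P.d) :
    P.bp m p = ∑ j, P.Gam p.1 p.2 j * P.sbpProb m p.1 j := by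
  rw [bp_eq P hψn hψe, Finset.sum_div]
  refine Finset.sum_congr rfl fun j _ => ?_
  rw [mul_div_assoc]; rfl

lemma sbpProb_sum (hd : 0 < P.d) (m : P.Msg) (hm : ∀ p, 0 < m p) (e : P.DirEdge) :
    ∑ j, P.sbpProb m e j = 1 := by
  simp only [GM.sbpProb]
  rw [← Finset.sum_div]
  exact div_self (Sden_pos P hψn hψe hd m hm e).ne'

lemma num_bds (m : P.Msg) (hm : ∀ p, 0 < m p) (p : P.DirEdge × Fin P.d) :
    0 ≤ (∑ j, P.Gam p.1 p.2 j * (P.bmass p.1 j * P.Mprod m p.1 j)) ∧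
    (∑ j, P.Gam p.1 p.2 j * (P.bmass p.1 j * P.Mprod m p.1 j)) ≤ Sden P m p.1 := by
  have h : ∀ j, 0 ≤ P.bmass p.1 j * P.Mprod m p.1 j := fun j =>
    (mul_pos (bmass_pos P hψn hψe _ _) (Mprod_pos P m hm _ _)).le
  exact ⟨Finset.sum_nonneg fun j _ => mul_nonneg (Gam_pos P hψn hψe _ _ _).le (h j),
    Finset.sum_le_sum fun j _ => mul_le_of_le_one_left (h j) (Gam_le P hψn hψe _ _ _)⟩

lemma bp_bds (hd : 0 < P.d) (m : P.Msg) (hm : ∀ p, 0 < m p) (p : P.DirEdge × Fin P.d) :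
    0 ≤ P.bp m p ∧ P.bp m p ≤ 1 := by
  rw [bp_eq P hψn hψe]
  have h := num_bds P hψn hψe m hm p
  have hS := Sden_pos P hψn hψe hd m hm p.1
  exact ⟨div_nonneg h.1 hS.le, (div_le_one hS).2 h.2⟩

lemma bp_lip (hd : 0 < P.d) (m ms : P.Msg) (hm : ∀ p, 0 < m p ∧ m p ≤ 1)
    (hms : ∀ p, 0 < ms p ∧ ms p ≤ 1) (p : P.DirEdge × Fin P.d) :
    |P.bp m p - P.bp ms p| ≤ ∑ q, Amat P ms p q * |m q - ms q| := by
  rw [Amat_mulVec P ms (fun q => |m q - ms q|), bp_eq P hψn hψe, bp_eq P hψn hψe]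
  have hb := num_bds P hψn hψe m (fun p => (hm p).1) p
  have key : ∀ k, |P.bmass p.1 k * P.Mprod m p.1 k - P.bmass p.1 k * P.Mprod ms p.1 k| ≤
      P.bmass p.1 k * ∑ w ∈ ((P.G.neighborFinset p.1.1.1).erase p.1.1.2).attach,
        |m (P.revEdge p.1 w, k) - ms (P.revEdge p.1 w, k)| := by
    intro k
    have h0 := (bmass_pos P hψn hψe p.1 k).le
    rw [← mul_sub, abs_mul, abs_of_nonneg h0]
    refine mul_le_mul_of_nonneg_left ?_ h0
    exact prod_lip _ _ _ (fun w => ⟨(hm _).1.le, (hm _).2⟩) (fun w => ⟨(hms _).1.le, (hms _).2⟩)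
  refine ratio_lip (Sden_pos P hψn hψe hd m (fun p => (hm p).1) p.1)
    (Sden_pos P hψn hψe hd ms (fun p => (hms p).1) p.1) hb.1 hb.2 ?_ ?_
  · rw [← Finset.sum_sub_distrib]
    refine (Finset.abs_sum_le_sum_abs _ _).trans (Finset.sum_le_sum fun k _ => ?_)
    rw [← mul_sub, abs_mul, abs_of_pos (Gam_pos P hψn hψe _ _ _)]
    exact (mul_le_of_le_one_left (abs_nonneg _) (Gam_le P hψn hψe _ _ _)).trans (key k)
  · simp only [Sden]
    rw [← Finset.sum_sub_distrib]
    exact (Finset.abs_sum_le_sum_abs _ _).trans (Finset.sum_le_sum fun k _ => key k)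

lemma Amat_nonneg (hd : 0 < P.d) (ms : P.Msg) (hms : ∀ p, 0 < ms p) (p q) :
    0 ≤ Amat P ms p q := by
  refine mul_nonneg (div_nonneg (mul_nonneg two_pos.le (bmass_pos P hψn hψe _ _).le)
    (Sden_pos P hψn hψe hd ms hms _).le) (Finset.sum_nonneg fun w _ => ?_)
  split_ifs <;> norm_num

lemma ball_bds (hd : 0 < P.d) (ms : P.Msg) (h : ms ∈ P.ball) (p) : 0 < ms p ∧ ms p ≤ 1 := by
  have : Nonempty (Fin P.d) := ⟨⟨0, hd⟩⟩
  have hpos : ∀ e i, 0 < ms (e, i) := by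
    intro e i
    refine lt_of_lt_of_le ?_ ((h e).2 i).1
    obtain ⟨j, hj⟩ := exists_eq_ciInf_of_finite (f := fun j => P.Gam e i j)
    rw [GM.beta0, ← hj]
    exact Gam_pos P hψn hψe e i j
  refine ⟨hpos p.1 p.2, ?_⟩
  rw [← (h p.1).1]
  exact Finset.single_le_sum (f := fun i => ms (p.1, i)) (fun i _ => (hpos _ i).le)
    (Finset.mem_univ p.2)

/-- Marginalising the product law. -/
lemma marg (hd : 0 < P.d) (m : P.Msg) (hm : ∀ p, 0 < m p) (p : P.DirEdge × Fin P.d) :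
    ∑ jj : P.DirEdge → Fin P.d, P.Gam p.1 p.2 (jj p.1) * ∏ e, P.sbpProb m e (jj e)
      = P.bp m p := by
  rw [bp_eq' P hψn hψe]
  have h1 : ∀ jj : P.DirEdge → Fin P.d,
      P.Gam p.1 p.2 (jj p.1) * ∏ e, P.sbpProb m e (jj e) =
      ∏ e, ((if e = p.1 then P.Gam p.1 p.2 (jj e) else 1) * P.sbpProb m e (jj e)) := by
    intro jj
    rw [Finset.prod_mul_distrib]
    simp
  rw [Finset.sum_congr rfl fun jj _ => h1 jj]
  rw [← Fintype.prod_sum (fun e j => (if e = p.1 then P.Gam p.1 p.2 j else 1) * P.sbpProb m e j)]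
  rw [Fintype.prod_eq_single p.1]
  · simp
  · intro e he
    simp [he, sbpProb_sum P hψn hψe hd m hm e]

end pos

lemma bp_meas (p : P.DirEdge × Fin P.d) : Measurable (fun m : P.Msg => P.bp m p) := by
  unfold GM.bp GM.Mprod
  fun_prop

/-- Orthogonality of a bounded past quantity to a centred discrete increment. -/
lemma orth {Ω K : Type*} [Fintype K] [DecidableEq K] [MeasurableSpace K]
    [MeasurableSingletonClass K]
    {m m0 : MeasurableSpace Ω} (hm : m ≤ m0) (μ : Measure Ω) [IsProbabilityMeasure μ]
    (X : Ω → K) (hX : Measurable[m0] X) (pr : K → Ω → ℝ)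
    (hpr : ∀ k, μ[(fun ω => if X ω = k then (1 : ℝ) else 0) | m] =ᵐ[μ] pr k)
    (N : Ω → ℝ) (hN : Measurable[m] N) (C : ℝ) (hC : ∀ ω, |N ω| ≤ C)
    (g : K → ℝ) (h : Ω → ℝ) (hh : ∀ ω, ∑ k, g k * pr k ω = h ω) :
    ∫ ω, N ω * (g (X ω)) ∂μ = ∫ ω, N ω * h ω ∂μ := by
  have hNm : StronglyMeasurable[m] N := hN.stronglyMeasurable
  have hI : ∀ k, Measurable[m0] (fun ω => if X ω = k then (1 : ℝ) else 0) := fun k =>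
    Measurable.ite (hX (measurableSet_singleton k)) measurable_const measurable_const
  have hIi : ∀ k, Integrable (fun ω => if X ω = k then (1 : ℝ) else 0) μ := fun k =>
    Integrable.of_bound (hI k).aestronglyMeasurable 1
      (Filter.Eventually.of_forall fun ω => by split_ifs <;> simp)
  have hNi : ∀ k, Integrable (N * fun ω => if X ω = k then (1 : ℝ) else 0) μ := fun k =>
    (hIi k).bdd_mul (hNm.mono hm).aestronglyMeasurable (Filter.Eventually.of_forall hC)
  have hce : ∀ k, μ[N * (fun ω => if X ω = k then (1 : ℝ) else 0) | m] =ᵐ[μ] N * pr k :=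
    fun k => (condExp_mul_of_stronglyMeasurable_left hNm (hNi k) (hIi k)).trans
      ((hpr k).mono fun ω hω => by simp [hω])
  have hint : ∀ k, Integrable (N * pr k) μ := fun k => integrable_condExp.congr (hce k)
  have heq : ∀ k, ∫ ω, (N * fun ω => if X ω = k then (1 : ℝ) else 0) ω ∂μ
      = ∫ ω, (N * pr k) ω ∂μ := fun k => by
    rw [← integral_condExp hm]
    exact integral_congr_ae (hce k)
  have e1 : ∀ ω, N ω * g (X ω) =
      ∑ k, g k * (N * fun ω => if X ω = k then (1 : ℝ) else 0) ω := by
    intro ω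
    simp
    ring
  have e2 : ∀ ω, N ω * h ω = ∑ k, g k * (N * pr k) ω := by
    intro ω
    rw [← hh, Finset.mul_sum]
    refine Finset.sum_congr rfl fun k _ => ?_
    simp only [Pi.mul_apply]; ring
  simp only [e1, e2]
  rw [integral_finsetSum _ fun k _ => (hNi k).const_mul _,
    integral_finsetSum _ fun k _ => (hint k).const_mul _]
  refine Finset.sum_congr rfl fun k _ => ?_
  rw [integral_const_mul, integral_const_mul, heq]


section main
set_option linter.unusedSectionVars false
variable (hd : 0 < P.d) (hψn : ∀ u j, 0 < P.ψn u j) (hψe : ∀ u v i j, 0 < P.ψe u v i j)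
  {Ω : Type*} {mΩ : MeasurableSpace Ω} {μ : Measure Ω} [IsProbabilityMeasure μ]
  {ℱ : Filtration ℕ mΩ} {m0 : P.Msg}
  {M : ℕ → Ω → P.Msg} {J : ℕ → Ω → P.DirEdge → Fin P.d}
  (hsbp : P.IsSBP μ ℱ (fun t => 1 / ((t : ℝ) + 1)) m0 M J)

/-- Centred increment. -/
noncomputable def Dv (M : ℕ → Ω → P.Msg) (J : ℕ → Ω → P.DirEdge → Fin P.d)
    (p : P.DirEdge × Fin P.d) (s : ℕ) (ω : Ω) : ℝ :=
  P.Gam p.1 p.2 (J (s + 1) ω p.1) - P.bp (M s ω) p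

noncomputable def Nv (M : ℕ → Ω → P.Msg) (J : ℕ → Ω → P.DirEdge → Fin P.d)
    (p : P.DirEdge × Fin P.d) (t : ℕ) (ω : Ω) : ℝ :=
  ∑ s ∈ Finset.Ico 1 t, Dv P M J p s ω

include hψn hψe hsbp

lemma M_bds (t : ℕ) (ht : 1 ≤ t) (ω : Ω) (p : P.DirEdge × Fin P.d) :
    0 < M t ω p ∧ M t ω p ≤ 1 := by
  obtain ⟨-, -, -, hrec, -⟩ := hsbp
  induction t, ht using Nat.le_induction with
  | base =>
    have h := hrec 0 ω p.1 p.2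
    simp at h
    rw [h]
    exact ⟨Gam_pos P hψn hψe _ _ _, Gam_le P hψn hψe _ _ _⟩
  | succ t ht ih =>
    have h := hrec t ω p.1 p.2
    simp only [Prod.mk.eta] at h
    rw [h]
    have hG := Gam_pos P hψn hψe p.1 p.2 (J (t + 1) ω p.1)
    have hG' := Gam_le P hψn hψe p.1 p.2 (J (t + 1) ω p.1)
    have ha : 0 < 1 / ((t : ℝ) + 1) := by positivity
    have ha' : 1 / ((t : ℝ) + 1) ≤ 1 := by
      rw [div_le_one (by positivity)]; linarith [(Nat.cast_nonneg t : (0 : ℝ) ≤ t)]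
    constructor
    · have := mul_pos ha hG
      have := mul_nonneg (sub_nonneg.2 ha') ih.1.le
      linarith
    · have := mul_le_mul_of_nonneg_left hG' ha.le
      have := mul_le_mul_of_nonneg_left ih.2 (sub_nonneg.2 ha')
      linarith

lemma M_decomp (ms : P.Msg) (p : P.DirEdge × Fin P.d) (t : ℕ) (ht : 1 ≤ t) (ω : Ω) :
    (t : ℝ) * (M t ω p - ms p) = (P.Gam p.1 p.2 (J 1 ω p.1) - ms p) + Nv P M J p t ω +
      ∑ s ∈ Finset.Ico 1 t, (P.bp (M s ω) p - ms p) := by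
  obtain ⟨-, -, -, hrec, -⟩ := hsbp
  induction t, ht using Nat.le_induction with
  | base =>
    have h := hrec 0 ω p.1 p.2
    simp at h
    simp [h, Nv]
  | succ t ht ih =>
    have h := hrec t ω p.1 p.2
    simp only [Prod.mk.eta] at h
    rw [Nv, Finset.sum_Ico_succ_top ht, Finset.sum_Ico_succ_top ht]
    rw [Nv] at ih
    have hpos : (t : ℝ) + 1 ≠ 0 := by positivity
    have e : ((t + 1 : ℕ) : ℝ) * (M (t + 1) ω p - ms p) =
        (t : ℝ) * (M t ω p - ms p) + (P.Gam p.1 p.2 (J (t + 1) ω p.1) - ms p) := by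
      rw [h]; push_cast; field_simp; ring
    rw [e, ih, Dv]
    ring

include hd

lemma Dv_bd (p : P.DirEdge × Fin P.d) (s : ℕ) (hs : 1 ≤ s) (ω : Ω) : |Dv P M J p s ω| ≤ 1 := by
  have h1 := Gam_pos P hψn hψe p.1 p.2 (J (s + 1) ω p.1)
  have h2 := Gam_le P hψn hψe p.1 p.2 (J (s + 1) ω p.1)
  have h3 := bp_bds P hψn hψe hd (M s ω) (fun q => (M_bds P hψn hψe hsbp s hs ω q).1) p
  rw [Dv, abs_le]
  constructor <;> linarith [h3.1, h3.2]

lemma Nv_bd (p : P.DirEdge × Fin P.d) (t : ℕ) (ω : Ω) : |Nv P M J p t ω| ≤ t := by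
  refine (Finset.abs_sum_le_sum_abs _ _).trans ?_
  refine (Finset.sum_le_sum fun s hs =>
    Dv_bd P hd hψn hψe hsbp p s (Finset.mem_Ico.1 hs).1 ω).trans ?_
  simp

omit hd hψn hψe [IsProbabilityMeasure μ] in
lemma bpM_meas (p : P.DirEdge × Fin P.d) (t : ℕ) :
    Measurable[ℱ t] (fun ω => P.bp (M t ω) p) :=
  (bp_meas P p).comp (hsbp.2.1 t)

omit hd hψn hψe [IsProbabilityMeasure μ] in
lemma Gam_meas (p : P.DirEdge × Fin P.d) (t : ℕ) :
    Measurable[ℱ (t + 1)] (fun ω => P.Gam p.1 p.2 (J (t + 1) ω p.1)) :=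
  (measurable_of_countable (fun jj : P.DirEdge → Fin P.d => P.Gam p.1 p.2 (jj p.1))).comp
    (hsbp.2.2.1 t)

omit hd hψn hψe [IsProbabilityMeasure μ] in
lemma Dv_meas (p : P.DirEdge × Fin P.d) (t : ℕ) : Measurable[ℱ (t + 1)] (Dv P M J p t) :=
  (Gam_meas P hsbp p t).sub ((bpM_meas P hsbp p t).mono (ℱ.mono (Nat.le_succ t)) le_rfl)

omit hd hψn hψe [IsProbabilityMeasure μ] in
lemma Nv_meas (p : P.DirEdge × Fin P.d) (t : ℕ) : Measurable[ℱ t] (Nv P M J p t) := by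
  refine Finset.measurable_fun_sum _ fun s hs => ?_
  exact (Dv_meas P hsbp p s).mono (ℱ.mono (Finset.mem_Ico.1 hs).2) le_rfl

lemma ND_zero (p : P.DirEdge × Fin P.d) (t : ℕ) (ht : 1 ≤ t) :
    ∫ ω, Nv P M J p t ω * Dv P M J p t ω ∂μ = 0 := by
  have hNm := Nv_meas P hsbp p t
  have hNi : Integrable (Nv P M J p t) μ := Integrable.of_bound
    (hNm.mono (ℱ.le t) le_rfl).aestronglyMeasurable t
    (Filter.Eventually.of_forall (Nv_bd P hd hψn hψe hsbp p t))
  have ho := orth (ℱ.le t) μ (J (t + 1)) ((hsbp.2.2.1 t).mono (ℱ.le _) le_rfl)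
    (fun jj ω => ∏ e : P.DirEdge, P.sbpProb (M t ω) e (jj e))
    (fun jj => by simpa only [funext_iff] using hsbp.2.2.2.2 t jj)
    (Nv P M J p t) hNm t (Nv_bd P hd hψn hψe hsbp p t)
    (fun jj => P.Gam p.1 p.2 (jj p.1)) (fun ω => P.bp (M t ω) p)
    (fun ω => marg P hψn hψe hd (M t ω) (fun q => (M_bds P hψn hψe hsbp t ht ω q).1) p)
  simp only [Dv, mul_sub]
  rw [integral_sub, ho, sub_self]
  · refine hNi.mul_bdd (c := 1) ((Gam_meas P hsbp p t).mono (ℱ.le _) le_rfl).aestronglyMeasurable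
      (Filter.Eventually.of_forall fun ω => ?_)
    rw [Real.norm_eq_abs, abs_of_pos (Gam_pos P hψn hψe _ _ _)]
    exact Gam_le P hψn hψe _ _ _
  · refine hNi.mul_bdd (c := 1) ((bpM_meas P hsbp p t).mono (ℱ.le _) le_rfl).aestronglyMeasurable
      (Filter.Eventually.of_forall fun ω => ?_)
    have h3 := bp_bds P hψn hψe hd (M t ω) (fun q => (M_bds P hψn hψe hsbp t ht ω q).1) p
    rw [Real.norm_eq_abs, abs_of_nonneg h3.1]
    exact h3.2

lemma N_sq (p : P.DirEdge × Fin P.d) (t : ℕ) (ht : 1 ≤ t) :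
    ∫ ω, Nv P M J p t ω ^ 2 ∂μ ≤ t := by
  induction t, ht using Nat.le_induction with
  | base => simp [Nv]
  | succ t ht ih =>
    have hNm : Measurable (Nv P M J p t) := (Nv_meas P hsbp p t).mono (ℱ.le t) le_rfl
    have hDm : Measurable (Dv P M J p t) := (Dv_meas P hsbp p t).mono (ℱ.le _) le_rfl
    have hN := Nv_bd P hd hψn hψe hsbp p t
    have hD := Dv_bd P hd hψn hψe hsbp p t ht
    have e : ∀ ω, Nv P M J p (t + 1) ω ^ 2 = (Nv P M J p t ω ^ 2 +
        2 * (Nv P M J p t ω * Dv P M J p t ω)) + Dv P M J p t ω ^ 2 := by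
      intro ω
      rw [Nv, Finset.sum_Ico_succ_top ht, ← Nv]; ring
    have i1 : Integrable (fun ω => Nv P M J p t ω ^ 2) μ :=
      Integrable.of_bound (hNm.pow_const 2).aestronglyMeasurable ((t : ℝ) ^ 2)
        (Filter.Eventually.of_forall fun ω => by
          rw [norm_pow]; exact pow_le_pow_left₀ (norm_nonneg _) (hN ω) 2)
    have i2 : Integrable (fun ω => Nv P M J p t ω * Dv P M J p t ω) μ :=
      Integrable.of_bound (hNm.mul hDm).aestronglyMeasurable ((t : ℝ) * 1)
        (Filter.Eventually.of_forall fun ω => by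
          rw [norm_mul]
          exact mul_le_mul (hN ω) (hD ω) (norm_nonneg _) (Nat.cast_nonneg t))
    have b3 : ∀ ω, Dv P M J p t ω ^ 2 ≤ 1 := fun ω => by
      rw [← sq_abs]; exact pow_le_one₀ (abs_nonneg _) (hD ω)
    have i3 : Integrable (fun ω => Dv P M J p t ω ^ 2) μ :=
      Integrable.of_bound (hDm.pow_const 2).aestronglyMeasurable 1
        (Filter.Eventually.of_forall fun ω => by
          rw [Real.norm_eq_abs, abs_of_nonneg (sq_nonneg _)]; exact b3 ω)
    have i3' : ∫ ω, Dv P M J p t ω ^ 2 ∂μ ≤ 1 := by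
      calc _ ≤ ∫ _, (1 : ℝ) ∂μ := integral_mono i3 (integrable_const _) b3
        _ = 1 := by simp
    simp only [e]
    have i12 : Integrable (fun ω => Nv P M J p t ω ^ 2 +
        2 * (Nv P M J p t ω * Dv P M J p t ω)) μ := i1.add (i2.const_mul 2)
    rw [integral_add i12 i3, integral_add i1 (i2.const_mul 2),
      integral_const_mul, ND_zero P hd hψn hψe hsbp p t ht]
    push_cast
    linarith

lemma N_abs (p : P.DirEdge × Fin P.d) (t : ℕ) (ht : 1 ≤ t) :
    ∫ ω, |Nv P M J p t ω| ∂μ ≤ Real.sqrt t := by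
  have hs : 0 < Real.sqrt t := Real.sqrt_pos.2 (by exact_mod_cast ht)
  have hs2 : Real.sqrt t ^ 2 = t := Real.sq_sqrt (Nat.cast_nonneg t)
  have hNm : Measurable (Nv P M J p t) := (Nv_meas P hsbp p t).mono (ℱ.le t) le_rfl
  have hN := Nv_bd P hd hψn hψe hsbp p t
  have i1 : Integrable (fun ω => Nv P M J p t ω ^ 2) μ :=
    Integrable.of_bound (hNm.pow_const 2).aestronglyMeasurable ((t : ℝ) ^ 2)
      (Filter.Eventually.of_forall fun ω => by
        rw [norm_pow]; exact pow_le_pow_left₀ (norm_nonneg _) (hN ω) 2)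
  have i0 : Integrable (Nv P M J p t) μ :=
    Integrable.of_bound hNm.aestronglyMeasurable t (Filter.Eventually.of_forall hN)
  have hsq := N_sq P hd hψn hψe hsbp p t ht
  have hpt : ∀ ω, 2 * Real.sqrt t * |Nv P M J p t ω| ≤ Nv P M J p t ω ^ 2 + t := by
    intro ω
    rw [← sq_abs (Nv P M J p t ω)]
    nlinarith [sq_nonneg (|Nv P M J p t ω| - Real.sqrt t)]
  have h := integral_mono (μ := μ) (i0.abs.const_mul (2 * Real.sqrt t))
    (i1.add (integrable_const (t : ℝ))) hpt
  rw [integral_const_mul] at h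
  have h2 : ∫ ω, (Nv P M J p t ω ^ 2 + (t : ℝ)) ∂μ
      = ∫ ω, Nv P M J p t ω ^ 2 ∂μ + t := by
    rw [integral_add i1 (integrable_const _)]; simp
  replace h := h.trans_eq h2
  have h3 : 2 * Real.sqrt t * ∫ ω, |Nv P M J p t ω| ∂μ ≤ 2 * Real.sqrt t * Real.sqrt t := by
    nlinarith
  exact le_of_mul_le_mul_left h3 (by positivity)

lemma err_int (ms : P.Msg) (hms : ∀ p, 0 < ms p ∧ ms p ≤ 1) (p : P.DirEdge × Fin P.d)
    (t : ℕ) (ht : 1 ≤ t) : Integrable (fun ω => |M t ω p - ms p|) μ := by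
  have hm : Measurable (fun ω => M t ω p) :=
    ((measurable_pi_apply p).comp (hsbp.2.1 t)).mono (ℱ.le t) le_rfl
  refine Integrable.abs (Integrable.of_bound (hm.sub_const _).aestronglyMeasurable 1
    (Filter.Eventually.of_forall fun ω => ?_))
  have h := M_bds P hψn hψe hsbp t ht ω p
  have h' := hms p
  rw [Real.norm_eq_abs, abs_le]
  constructor <;> linarith [h.1, h.2, h'.1, h'.2]

lemma err_rec (ms : P.Msg) (hms : ∀ p, 0 < ms p ∧ ms p ≤ 1) (hfix : P.bp ms = ms)
    (p : P.DirEdge × Fin P.d) (t : ℕ) (ht : 1 ≤ t) :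
    (t : ℝ) * ∫ ω, |M t ω p - ms p| ∂μ ≤ 1 + Real.sqrt t +
      ∑ s ∈ Finset.Ico 1 t, ∑ q, Amat P ms p q * ∫ ω, |M s ω q - ms q| ∂μ := by
  have hei := fun q s hs => err_int P hd hψn hψe hsbp ms hms q s hs
  have hNm : Measurable (Nv P M J p t) := (Nv_meas P hsbp p t).mono (ℱ.le t) le_rfl
  have i0 : Integrable (fun ω => |Nv P M J p t ω|) μ :=
    (Integrable.of_bound hNm.aestronglyMeasurable t
      (Filter.Eventually.of_forall (Nv_bd P hd hψn hψe hsbp p t))).abs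
  have iA : ∀ s ∈ Finset.Ico 1 t, Integrable (fun ω => ∑ q, Amat P ms p q * |M s ω q - ms q|) μ :=
    fun s hs => integrable_finsetSum _ fun q _ => (hei q s (Finset.mem_Ico.1 hs).1).const_mul _
  have hpt : ∀ ω, (t : ℝ) * |M t ω p - ms p| ≤ (1 + |Nv P M J p t ω|) +
      ∑ s ∈ Finset.Ico 1 t, ∑ q, Amat P ms p q * |M s ω q - ms q| := by
    intro ω
    have hab : (t : ℝ) * |M t ω p - ms p| = |(t : ℝ) * (M t ω p - ms p)| := by
      rw [abs_mul, Nat.abs_cast]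
    rw [hab, M_decomp P hψn hψe hsbp ms p t ht ω]
    refine (abs_add_le _ _).trans (add_le_add ((abs_add_le _ _).trans (add_le_add ?_ le_rfl)) ?_)
    · have h1 := Gam_pos P hψn hψe p.1 p.2 (J 1 ω p.1)
      have h2 := Gam_le P hψn hψe p.1 p.2 (J 1 ω p.1)
      have h' := hms p
      rw [abs_le]
      constructor <;> linarith [h'.1, h'.2]
    · refine (Finset.abs_sum_le_sum_abs _ _).trans (Finset.sum_le_sum fun s hs => ?_)
      have h := bp_lip P hψn hψe hd (M s ω) ms
        (M_bds P hψn hψe hsbp s (Finset.mem_Ico.1 hs).1 ω) hms p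
      rwa [hfix] at h
  have h := integral_mono (μ := μ) ((hei p t ht).const_mul (t : ℝ))
    (((integrable_const (1 : ℝ)).add i0).add (integrable_finsetSum _ iA)) hpt
  rw [integral_const_mul] at h
  refine h.trans (le_of_eq_of_le (integral_add ((integrable_const (1 : ℝ)).add i0)
    (integrable_finsetSum _ iA)) ?_)
  refine add_le_add ?_ (le_of_eq ?_)
  · refine le_of_eq_of_le (integral_add (integrable_const (1 : ℝ)) i0) ?_
    have := N_abs P hd hψn hψe hsbp p t ht
    simpa using this
  · rw [integral_finsetSum _ iA]
    refine Finset.sum_congr rfl fun s hs => ?_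
    rw [integral_finsetSum _ fun q _ => (hei q s (Finset.mem_Ico.1 hs).1).const_mul _]
    simp only [integral_const_mul]

end main

/-- Solving the recursion. -/
lemma solve {ι : Type*} [Fintype ι] (A : Matrix ι ι ℝ) (hA : ∀ p q, 0 ≤ A p q)
    (B : ι → ℝ) (hB0 : ∀ p, 0 ≤ B p) (hB : ∀ p, B p = 4 + 2 * ∑ q, A p q * B q)
    (x : ℕ → ι → ℝ)
    (hx : ∀ t : ℕ, 1 ≤ t → ∀ p, (t : ℝ) * x t p ≤ 1 + Real.sqrt t +
      ∑ s ∈ Finset.Ico 1 t, ∑ q, A p q * x s q) :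
    ∀ t : ℕ, 1 ≤ t → ∀ p, x t p ≤ B p * (1 / Real.sqrt t) := by
  intro t
  induction t using Nat.strong_induction_on with
  | _ t ih =>
    intro ht p
    have hs1 : 1 ≤ Real.sqrt t := Real.one_le_sqrt.2 (by exact_mod_cast ht)
    have hs2 : Real.sqrt t * Real.sqrt t = t := Real.mul_self_sqrt (Nat.cast_nonneg t)
    have h1 : ∑ s ∈ Finset.Ico 1 t, ∑ q, A p q * x s q ≤
        (∑ s ∈ Finset.Ico 1 t, 1 / Real.sqrt s) * ∑ q, A p q * B q := by
      rw [Finset.sum_mul]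
      refine Finset.sum_le_sum fun s hs => ?_
      rw [Finset.mul_sum]
      refine Finset.sum_le_sum fun q _ => ?_
      have := mul_le_mul_of_nonneg_left
        (ih s (Finset.mem_Ico.1 hs).2 (Finset.mem_Ico.1 hs).1 q) (hA p q)
      linarith
    have h2 : 0 ≤ ∑ q, A p q * B q := Finset.sum_nonneg fun q _ => mul_nonneg (hA _ _) (hB0 _)
    have h3 := mul_le_mul_of_nonneg_right (sum_inv_sqrt t) h2
    have h4 := hx t ht p
    have h5 : Real.sqrt t * (x t p * Real.sqrt t) ≤ Real.sqrt t * B p := by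
      have e : Real.sqrt t * (x t p * Real.sqrt t) = t * x t p := by
        linear_combination (x t p) * hs2
      rw [e, hB p]
      nlinarith
    have h6 := le_of_mul_le_mul_left h5 (by linarith)
    rw [mul_one_div, le_div_iff₀ (by linarith)]
    exact h6

end SBPaux

/-- On any tree-structured pairwise MRF, for the SBP sequence with step size
`α_t = 1/(t+1)`, there exists a nonnegative matrix `A` which is nilpotent of degree at most
`r = diam(G)` such that `E[|m^t − m*|] ⪯ 4 (I − 2A)⁻¹ (1/√t) 𝟏` elementwise, for all `t ≥ 1`. -/
theorem sbp_tree_expected_error_bound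
    {V : Type*} [Fintype V] [DecidableEq V] (P : GM V)
    (hd : 0 < P.d)
    (htree : P.G.IsTree)
    (hψn : ∀ u j, 0 < P.ψn u j)
    (hψe : ∀ u v i j, 0 < P.ψe u v i j)
    (hψsymm : ∀ u v i j, P.ψe u v i j = P.ψe v u j i)
    {Ω : Type*} {mΩ : MeasurableSpace Ω} (μ : Measure Ω) [IsProbabilityMeasure μ]
    (ℱ : Filtration ℕ mΩ) (m0 : P.Msg)
    (hm0 : ∀ e : P.DirEdge, (∑ i, m0 (e, i)) = 1 ∧ ∀ i, 0 ≤ m0 (e, i))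
    (M : ℕ → Ω → P.Msg) (J : ℕ → Ω → P.DirEdge → Fin P.d)
    (hsbp : P.IsSBP μ ℱ (fun t => 1 / ((t : ℝ) + 1)) m0 M J)
    (mstar : P.Msg) (hstar : mstar ∈ P.ball) (hfix : P.bp mstar = mstar) :
    ∃ A : Matrix (P.DirEdge × Fin P.d) (P.DirEdge × Fin P.d) ℝ,
      (∀ p q, 0 ≤ A p q) ∧
      A ^ P.graphDiam = 0 ∧
      ∀ t : ℕ, 1 ≤ t → ∀ p : P.DirEdge × Fin P.d,
        (∫ ω, |M t ω p - mstar p| ∂μ) ≤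
          4 * ((1 - (2 : ℝ) • A)⁻¹.mulVec (fun _ => 1 / Real.sqrt t)) p := by
  have hms := SBPaux.ball_bds P hψn hψe hd mstar hstar
  have hA := SBPaux.Amat_nonneg P hψn hψe hd mstar (fun p => (hms p).1)
  have hnil := SBPaux.Amat_nil P htree mstar
  refine ⟨SBPaux.Amat P mstar, hA, hnil, fun t ht p => ?_⟩
  have hr := SBPaux.resolvent (SBPaux.Amat P mstar) hA _ hnil 4 (by norm_num)
  have h := SBPaux.solve (SBPaux.Amat P mstar) hA _ hr.1 hr.2
    (fun t p => ∫ ω, |M t ω p - mstar p| ∂μ)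
    (fun t ht p => SBPaux.err_rec P hd hψn hψe hsbp mstar hms hfix p t ht) t ht p
  refine h.trans (le_of_eq ?_)
  simp only [Matrix.mulVec, dotProduct, ← Finset.sum_mul]
  ring
end

section
/- Suppose the BP update function F satisfies the contraction condition ‖F(m) − F(m′)‖₂ ≤ (1 − λ/2)‖m − m′‖₂ for all message vectors m, m′ ∈ B, for some 0 < λ < 2. Then F has a unique fixed point m* in B, and the SBP message sequence {m^t}, generated with positive step sizes α_t satisfying ∑_t α_t = ∞ and ∑_t α_t² < ∞ (e.g., α_t = Θ(1/t)), converges almost surely to m* as t → ∞. -/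
open Finset MeasureTheory Filter

theorem sbpaux_supermart_conv {Ω : Type*} {mΩ : MeasurableSpace Ω} (μ : Measure Ω)
    [IsProbabilityMeasure μ] (ℱ : Filtration ℕ mΩ) (U : ℕ → Ω → ℝ)
    (hadp : StronglyAdapted ℱ U) (hint : ∀ t, Integrable (U t) μ) (hnn : ∀ t ω, 0 ≤ U t ω)
    (hsup : ∀ t, μ[U (t+1) | ℱ t] ≤ᵐ[μ] U t) :
    ∀ᵐ ω ∂μ, ∃ c, Tendsto (fun t => U t ω) atTop (nhds c) := by
  have hS : Supermartingale U ℱ μ := supermartingale_nat hadp hint hsup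
  have hI : ∀ t, ∫ ω, U t ω ∂μ ≤ ∫ ω, U 0 ω ∂μ := by
    intro t
    have := hS.setIntegral_le (Nat.zero_le t) (MeasurableSet.univ)
    simpa using this
  have hb : ∀ t, eLpNorm ((-U) t) 1 μ ≤ ((∫ ω, U 0 ω ∂μ).toNNReal : ENNReal) := by
    intro t
    rw [Pi.neg_apply, eLpNorm_neg, eLpNorm_one_eq_lintegral_enorm,
      ← ofReal_integral_norm_eq_lintegral_enorm (hint t)]
    change _ ≤ ENNReal.ofReal _
    apply ENNReal.ofReal_le_ofReal
    have : ∀ ω, ‖U t ω‖ = U t ω := fun ω => by rw [Real.norm_of_nonneg (hnn t ω)]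
    simp only [this]
    exact hI t
  filter_upwards [hS.neg.exists_ae_tendsto_of_bdd hb] with ω ⟨c, hc⟩
  exact ⟨-c, by simpa using hc.neg⟩

theorem sbpaux_limit_zero (α X : ℕ → ℝ) (hα : ∀ t, 0 < α t) (hX : ∀ t, 0 ≤ X t)
    (hαdiv : Tendsto (fun n => ∑ t ∈ Finset.range n, α t) atTop atTop)
    (c : ℝ) (hc : Tendsto X atTop (nhds c)) (s : ℝ)
    (hs : Tendsto (fun n => ∑ t ∈ Finset.range n, α t * X t) atTop (nhds s)) :
    Tendsto X atTop (nhds 0) := by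
  have hc0 : 0 ≤ c := ge_of_tendsto' hc hX
  rcases hc0.eq_or_lt with h | h
  · rwa [h]
  exfalso
  have hsum : Summable fun t => α t * X t :=
    ((hasSum_iff_tendsto_nat_of_nonneg (fun t => mul_nonneg (hα t).le (hX t)) s).2 hs).summable
  have hsum2 : Summable α := by
    refine Summable.of_norm_bounded_eventually_nat (hsum.mul_left (2 / c)) ?_
    filter_upwards [hc.eventually (lt_mem_nhds (half_lt_self h))] with t ht
    rw [Real.norm_of_nonneg (hα t).le]
    have : α t * (c / 2) ≤ α t * X t := mul_le_mul_of_nonneg_left ht.le (hα t).le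
    calc α t = 2 / c * (α t * (c / 2)) := by field_simp
      _ ≤ _ := mul_le_mul_of_nonneg_left this (by positivity)
  exact not_tendsto_nhds_of_tendsto_atTop hαdiv _ hsum2.hasSum.tendsto_sum_nat

theorem sbpaux_rs {Ω : Type*} {mΩ : MeasurableSpace Ω} (μ : Measure Ω)
    [IsProbabilityMeasure μ] (ℱ : Filtration ℕ mΩ) (X : ℕ → Ω → ℝ)
    (hadp : StronglyAdapted ℱ X) (K : ℝ) (hnn : ∀ t ω, 0 ≤ X t ω) (hK : ∀ t ω, X t ω ≤ K)
    (α : ℕ → ℝ) (hα : ∀ t, 0 < α t)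
    (hαdiv : Tendsto (fun n => ∑ t ∈ Finset.range n, α t) atTop atTop)
    (hαsq : Summable fun t => (α t) ^ 2) (lam C : ℝ) (hlam : 0 < lam) (hC : 0 ≤ C)
    (hrec : ∀ t, ∀ᵐ ω ∂μ, (μ[X (t+1) | ℱ t]) ω ≤ (1 - lam * α t) * X t ω + C * α t ^ 2) :
    ∀ᵐ ω ∂μ, Tendsto (fun t => X t ω) atTop (nhds 0) := by
  have hint : ∀ t, Integrable (X t) μ := fun t =>
    Integrable.of_bound ((hadp t).mono (ℱ.le t)).aestronglyMeasurable K
      (ae_of_all _ fun ω => by rw [Real.norm_of_nonneg (hnn t ω)]; exact hK t ω)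
  have key : ∀ b, 0 ≤ b → b ≤ lam → ∀ᵐ ω ∂μ, ∃ c, Tendsto (fun t => X t ω +
      (b * (∑ s ∈ range t, α s * X s ω) + (C * (∑' s, α s ^ 2) - C * ∑ s ∈ range t, α s ^ 2)))
      atTop (nhds c) := by
    intro b hb0 hb
    have hR : ∀ t r, r ≤ t + 1 → StronglyMeasurable[ℱ t] (fun ω => (b * (∑ s ∈ range r, α s * X s ω)
        + (C * (∑' s, α s ^ 2) - C * ∑ s ∈ range r, α s ^ 2))) := by
      intro t r hr
      refine StronglyMeasurable.add (StronglyMeasurable.const_mul ?_ b) stronglyMeasurable_const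
      refine Finset.stronglyMeasurable_fun_sum _ fun s hs => ?_
      refine StronglyMeasurable.const_mul ?_ _
      have : s < r := by simpa using hs
      exact (hadp s).mono (ℱ.mono (by omega))
    have hRi : ∀ r, Integrable (fun ω => (b * (∑ s ∈ range r, α s * X s ω)
        + (C * (∑' s, α s ^ 2) - C * ∑ s ∈ range r, α s ^ 2))) μ := by
      intro r
      refine Integrable.add (Integrable.const_mul ?_ b) (integrable_const _)
      exact integrable_finsetSum _ fun s _ => (hint s).const_mul _
    apply sbpaux_supermart_conv μ ℱ
    · intro t
      exact (hadp t).add (hR t t (by omega))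
    · intro t
      exact (hint t).add (hRi t)
    · intro t ω
      have h1 : ∑ s ∈ range t, α s ^ 2 ≤ ∑' s, α s ^ 2 :=
        hαsq.sum_le_tsum _ (fun _ _ => sq_nonneg _)
      have h2 : 0 ≤ ∑ s ∈ range t, α s * X s ω :=
        Finset.sum_nonneg fun s _ => mul_nonneg (hα s).le (hnn s ω)
      have := mul_le_mul_of_nonneg_left h1 hC
      have := mul_nonneg hb0 h2
      have := hnn t ω
      linarith
    · intro t
      have h1 := condExp_add (hint (t+1)) (hRi (t+1)) (ℱ t)
      have h2 := condExp_of_stronglyMeasurable (ℱ.le t) (hR t (t+1) le_rfl) (hRi (t+1))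
      rw [h2] at h1
      filter_upwards [h1, hrec t] with ω h1 h3
      refine h1.trans_le ?_
      rw [Pi.add_apply, Finset.sum_range_succ, Finset.sum_range_succ]
      have : b * (α t * X t ω) ≤ lam * (α t * X t ω) :=
        mul_le_mul_of_nonneg_right hb (mul_nonneg (hα t).le (hnn t ω))
      linarith
  have hT : Tendsto (fun t => C * (∑' s, α s ^ 2) - C * ∑ s ∈ range t, α s ^ 2) atTop
      (nhds (C * (∑' s, α s ^ 2) - C * (∑' s, α s ^ 2))) :=
    tendsto_const_nhds.sub (hαsq.hasSum.tendsto_sum_nat.const_mul C)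
  filter_upwards [key 0 le_rfl hlam.le, key lam hlam.le le_rfl] with ω ⟨c0, h0⟩ ⟨c1, h1⟩
  have e1 := (h0.sub hT)
  have e2 := (h1.sub h0).const_mul lam⁻¹
  refine sbpaux_limit_zero α (fun t => X t ω) hα (fun t => hnn t ω) hαdiv _
    (e1.congr fun t => ?_) _ (e2.congr fun t => ?_)
  · ring
  · field_simp
    ring

namespace GM

variable {V : Type*} [Fintype V] [DecidableEq V] (P : GM V)

theorem sbpaux_bmass_pos (hd : 0 < P.d) (hψn : ∀ u j, 0 < P.ψn u j)
    (hψe : ∀ u v i j, 0 < P.ψe u v i j) (e : P.DirEdge) (j : Fin P.d) : 0 < P.bmass e j :=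
  mul_pos (hψn _ _) (Finset.sum_pos (fun i _ => hψe _ _ _ _) ⟨⟨0, hd⟩, mem_univ _⟩)

theorem sbpaux_Gam_pos (hd : 0 < P.d) (hψn : ∀ u j, 0 < P.ψn u j)
    (hψe : ∀ u v i j, 0 < P.ψe u v i j) (e : P.DirEdge) (i j : Fin P.d) : 0 < P.Gam e i j :=
  div_pos (mul_pos (hψe _ _ _ _) (hψn _ _)) (P.sbpaux_bmass_pos hd hψn hψe e j)

theorem sbpaux_Gam_sum (hd : 0 < P.d) (hψn : ∀ u j, 0 < P.ψn u j)
    (hψe : ∀ u v i j, 0 < P.ψe u v i j) (e : P.DirEdge) (j : Fin P.d) :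
    ∑ i, P.Gam e i j = 1 := by
  have h := P.sbpaux_bmass_pos hd hψn hψe e j
  unfold Gam
  rw [← Finset.sum_div, ← Finset.sum_mul, div_eq_one_iff_eq h.ne', bmass, mul_comm]

theorem sbpaux_beta0_pos (hd : 0 < P.d) (hψn : ∀ u j, 0 < P.ψn u j)
    (hψe : ∀ u v i j, 0 < P.ψe u v i j) (e : P.DirEdge) (i : Fin P.d) : 0 < P.beta0 e i := by
  haveI : Nonempty (Fin P.d) := ⟨⟨0, hd⟩⟩
  obtain ⟨j, hj⟩ := exists_eq_ciInf_of_finite (f := fun j => P.Gam e i j)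
  unfold beta0
  rw [← hj]
  exact P.sbpaux_Gam_pos hd hψn hψe e i j

theorem sbpaux_Gam_mem (e : P.DirEdge) (i j : Fin P.d) :
    P.beta0 e i ≤ P.Gam e i j ∧ P.Gam e i j ≤ P.mu0 e i :=
  ⟨ciInf_le (Set.finite_range _).bddBelow j, le_ciSup (Set.finite_range _).bddAbove j⟩

theorem sbpaux_ball_unit (hd : 0 < P.d) (hψn : ∀ u j, 0 < P.ψn u j)
    (hψe : ∀ u v i j, 0 < P.ψe u v i j) {m : P.Msg} (hm : m ∈ P.ball) (k) :
    0 < m k ∧ m k ≤ 1 := by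
  have hp : ∀ e i, 0 < m (e, i) := fun e i =>
    (P.sbpaux_beta0_pos hd hψn hψe e i).trans_le ((hm e).2 i).1
  refine ⟨hp k.1 k.2, ?_⟩
  rw [← (hm k.1).1]
  exact Finset.single_le_sum (f := fun i => m (k.1, i)) (fun i _ => (hp k.1 i).le) (mem_univ k.2)

theorem sbpaux_Gam_unit (hd : 0 < P.d) (hψn : ∀ u j, 0 < P.ψn u j)
    (hψe : ∀ u v i j, 0 < P.ψe u v i j) (e : P.DirEdge) (i j : Fin P.d) :
    0 ≤ P.Gam e i j ∧ P.Gam e i j ≤ 1 := by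
  refine ⟨(P.sbpaux_Gam_pos hd hψn hψe e i j).le, ?_⟩
  rw [← P.sbpaux_Gam_sum hd hψn hψe e j]
  exact Finset.single_le_sum (f := fun i => P.Gam e i j)
    (fun i _ => (P.sbpaux_Gam_pos hd hψn hψe e i j).le) (mem_univ i)

theorem sbpaux_w_pos (hd : 0 < P.d) (hψn : ∀ u j, 0 < P.ψn u j)
    (hψe : ∀ u v i j, 0 < P.ψe u v i j) {m : P.Msg} (hm : m ∈ P.ball) (e : P.DirEdge) (j) :
    0 < P.bmass e j * P.Mprod m e j :=
  mul_pos (P.sbpaux_bmass_pos hd hψn hψe e j)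
    (Finset.prod_pos fun _ _ => (P.sbpaux_ball_unit hd hψn hψe hm _).1)

theorem sbpaux_prob_nonneg (hd : 0 < P.d) (hψn : ∀ u j, 0 < P.ψn u j)
    (hψe : ∀ u v i j, 0 < P.ψe u v i j) {m : P.Msg} (hm : m ∈ P.ball) (e : P.DirEdge) (j) :
    0 ≤ P.sbpProb m e j :=
  div_nonneg (P.sbpaux_w_pos hd hψn hψe hm e j).le
    (Finset.sum_nonneg fun k _ => (P.sbpaux_w_pos hd hψn hψe hm e k).le)

theorem sbpaux_prob_sum (hd : 0 < P.d) (hψn : ∀ u j, 0 < P.ψn u j)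
    (hψe : ∀ u v i j, 0 < P.ψe u v i j) {m : P.Msg} (hm : m ∈ P.ball) (e : P.DirEdge) :
    ∑ j, P.sbpProb m e j = 1 := by
  unfold sbpProb
  rw [← Finset.sum_div]
  exact div_self (Finset.sum_pos (fun k _ => P.sbpaux_w_pos hd hψn hψe hm e k)
    ⟨⟨0, hd⟩, mem_univ _⟩).ne'

theorem sbpaux_bp_eq (hd : 0 < P.d) (hψn : ∀ u j, 0 < P.ψn u j)
    (hψe : ∀ u v i j, 0 < P.ψe u v i j) (m : P.Msg) (e : P.DirEdge) (i : Fin P.d) :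
    P.bp m (e, i) = ∑ j, P.sbpProb m e j * P.Gam e i j := by
  have h := fun j => (P.sbpaux_bmass_pos hd hψn hψe e j).ne'
  unfold bp sbpProb
  simp only [div_mul_eq_mul_div]
  rw [← Finset.sum_div]
  congr 1
  · refine Finset.sum_congr rfl fun j _ => ?_
    have := h j
    unfold Gam
    field_simp
  · rw [Finset.sum_comm]
    refine Finset.sum_congr rfl fun j _ => ?_
    rw [← Finset.sum_mul, ← Finset.sum_mul, bmass]
    ring

theorem sbpaux_bp_mem (hd : 0 < P.d) (hψn : ∀ u j, 0 < P.ψn u j)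
    (hψe : ∀ u v i j, 0 < P.ψe u v i j) {m : P.Msg} (hm : m ∈ P.ball) : P.bp m ∈ P.ball := by
  intro e
  have hp := P.sbpaux_prob_nonneg hd hψn hψe hm e
  have hs := P.sbpaux_prob_sum hd hψn hψe hm e
  simp only [P.sbpaux_bp_eq hd hψn hψe]
  refine ⟨?_, fun i => ⟨?_, ?_⟩⟩
  · rw [Finset.sum_comm]
    simp only [← Finset.mul_sum, P.sbpaux_Gam_sum hd hψn hψe, mul_one, hs]
  · calc P.beta0 e i = ∑ j, P.sbpProb m e j * P.beta0 e i := by rw [← Finset.sum_mul, hs, one_mul]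
      _ ≤ _ := Finset.sum_le_sum fun j _ =>
        mul_le_mul_of_nonneg_left (P.sbpaux_Gam_mem e i j).1 (hp j)
  · calc _ ≤ ∑ j, P.sbpProb m e j * P.mu0 e i := Finset.sum_le_sum fun j _ =>
        mul_le_mul_of_nonneg_left (P.sbpaux_Gam_mem e i j).2 (hp j)
      _ = P.mu0 e i := by rw [← Finset.sum_mul, hs, one_mul]

theorem sbpaux_step_mem (hd : 0 < P.d) (hψn : ∀ u j, 0 < P.ψn u j)
    (hψe : ∀ u v i j, 0 < P.ψe u v i j) {m m' : P.Msg} (hm : m ∈ P.ball) {a : ℝ}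
    (ha : a ∈ Set.Ioo (0:ℝ) 1) (jj : P.DirEdge → Fin P.d)
    (h : ∀ e i, m' (e, i) = (1 - a) * m (e, i) + a * P.Gam e i (jj e)) : m' ∈ P.ball := by
  intro e
  simp only [h]
  refine ⟨?_, fun i => ?_⟩
  · rw [Finset.sum_add_distrib, ← Finset.mul_sum, ← Finset.mul_sum, (hm e).1,
      P.sbpaux_Gam_sum hd hψn hψe]
    ring
  · have h1 := (hm e).2 i
    have h2 := P.sbpaux_Gam_mem e i (jj e)
    have h3 := ha.1.le
    have h4 : 0 ≤ 1 - a := by linarith [ha.2]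
    constructor
    · nlinarith [mul_le_mul_of_nonneg_left h1.1 h4, mul_le_mul_of_nonneg_left h2.1 h3]
    · nlinarith [mul_le_mul_of_nonneg_left h1.2 h4, mul_le_mul_of_nonneg_left h2.2 h3]

theorem sbpaux_isClosed_ball : IsClosed P.ball := by
  have : P.ball = ⋂ e : P.DirEdge, ({m : P.Msg | (∑ i, m (e, i)) = 1} ∩
      ⋂ i, ({m : P.Msg | P.beta0 e i ≤ m (e, i)} ∩ {m : P.Msg | m (e, i) ≤ P.mu0 e i})) := by
    ext m
    simp [ball]
  rw [this]
  refine isClosed_iInter fun e => IsClosed.inter ?_ (isClosed_iInter fun i => IsClosed.inter ?_ ?_)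
  · exact isClosed_eq (by fun_prop) continuous_const
  · exact isClosed_le continuous_const (by fun_prop)
  · exact isClosed_le (by fun_prop) continuous_const

theorem sbpaux_joint_sum {p : P.DirEdge → Fin P.d → ℝ} (hp : ∀ e, ∑ j, p e j = 1) :
    ∑ jj : P.DirEdge → Fin P.d, ∏ e, p e (jj e) = 1 := by
  have := Finset.prod_univ_sum (fun _ : P.DirEdge => (univ : Finset (Fin P.d))) p
  rw [Fintype.piFinset_univ] at this
  rw [← this]
  simp [hp]

theorem sbpaux_joint_marg {p : P.DirEdge → Fin P.d → ℝ} (hp : ∀ e, ∑ j, p e j = 1)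
    (e : P.DirEdge) (g : Fin P.d → ℝ) :
    ∑ jj : P.DirEdge → Fin P.d, (∏ e, p e (jj e)) * g (jj e) = ∑ j, p e j * g j := by
  have := Finset.prod_univ_sum (fun _ : P.DirEdge => (univ : Finset (Fin P.d)))
    (fun e' j => p e' j * if e' = e then g j else 1)
  rw [Fintype.piFinset_univ] at this
  simp only [Finset.prod_mul_distrib, Finset.prod_ite_eq', mem_univ, if_true] at this
  rw [← this, Finset.prod_eq_single e]
  · simp
  · intro b _ hb
    simp [hb, hp]
  · simp

theorem sbpaux_fixed (hd : 0 < P.d) (hψn : ∀ u j, 0 < P.ψn u j)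
    (hψe : ∀ u v i j, 0 < P.ψe u v i j) (lam : ℝ) (hlam0 : 0 < lam) (hlam2 : lam < 2)
    (hcontr : ∀ m ∈ P.ball, ∀ m' ∈ P.ball,
      l2norm (P.bp m - P.bp m') ≤ (1 - lam / 2) * l2norm (m - m'))
    (m0 : P.Msg) (hm0 : m0 ∈ P.ball) : ∃ m ∈ P.ball, P.bp m = m := by
  let f : EuclideanSpace ℝ (P.DirEdge × Fin P.d) → EuclideanSpace ℝ (P.DirEdge × Fin P.d) :=
    fun x => WithLp.toLp 2 (P.bp (WithLp.ofLp x))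
  let s : Set (EuclideanSpace ℝ (P.DirEdge × Fin P.d)) := {x | WithLp.ofLp x ∈ P.ball}
  have hs : IsClosed s := P.sbpaux_isClosed_ball.preimage (PiLp.continuous_ofLp 2 _)
  have hf : Set.MapsTo f s s := fun x hx => P.sbpaux_bp_mem hd hψn hψe hx
  have hdist : ∀ x y : EuclideanSpace ℝ (P.DirEdge × Fin P.d),
      dist x y = l2norm (WithLp.ofLp x - WithLp.ofLp y) := by
    intro x y
    rw [EuclideanSpace.dist_eq]
    simp [l2norm, Real.dist_eq, sq_abs]
  have hc : ContractingWith (1 - lam / 2).toNNReal (hf.restrict f s s) := by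
    refine ⟨?_, LipschitzWith.of_dist_le_mul ?_⟩
    · rw [Real.toNNReal_lt_one]
      linarith
    · rintro ⟨x, hx⟩ ⟨y, hy⟩
      rw [Real.coe_toNNReal _ (by linarith), Subtype.dist_eq, Subtype.dist_eq, hdist, hdist]
      exact hcontr _ hx _ hy
  obtain ⟨y, hy, hfy, -⟩ := ContractingWith.exists_fixedPoint' hs.isComplete hf hc
    (x := WithLp.toLp 2 m0) hm0 (edist_ne_top _ _)
  exact ⟨WithLp.ofLp y, hy, congrArg WithLp.ofLp hfy⟩

theorem sbpaux_drift (hd : 0 < P.d) (hψn : ∀ u j, 0 < P.ψn u j)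
    (hψe : ∀ u v i j, 0 < P.ψe u v i j) (lam : ℝ) 
    (hcontr : ∀ m ∈ P.ball, ∀ m' ∈ P.ball,
      l2norm (P.bp m - P.bp m') ≤ (1 - lam / 2) * l2norm (m - m'))
    (x : P.Msg) (hx : x ∈ P.ball) (hfx : P.bp x = x) (m : P.Msg) (hm : m ∈ P.ball)
    (a : ℝ) (ha : 0 < a) :
    ∑ jj : P.DirEdge → Fin P.d, (∑ k : P.DirEdge × Fin P.d,
        ((1 - a) * m k + a * P.Gam k.1 k.2 (jj k.1) - x k) ^ 2) * ∏ e, P.sbpProb m e (jj e)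
      ≤ (1 - lam * a) * (∑ k, (m k - x k) ^ 2)
        + (Fintype.card (P.DirEdge × Fin P.d) : ℝ) * a ^ 2 := by
  have hs := P.sbpaux_prob_sum hd hψn hψe hm
  have h1 : ∀ k : P.DirEdge × Fin P.d, ∑ jj : P.DirEdge → Fin P.d,
      ((1 - a) * m k + a * P.Gam k.1 k.2 (jj k.1) - x k) ^ 2 * ∏ e, P.sbpProb m e (jj e)
      ≤ (m k - x k) ^ 2 + 2 * a * ((m k - x k) * (P.bp m k - m k)) + a ^ 2 := by
    intro k
    calc _ ≤ ∑ jj : P.DirEdge → Fin P.d,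
          (((m k - x k) ^ 2 - 2 * a * ((m k - x k) * m k) + a ^ 2) * ∏ e, P.sbpProb m e (jj e)
            + 2 * a * (m k - x k) *
              ((∏ e, P.sbpProb m e (jj e)) * P.Gam k.1 k.2 (jj k.1))) := by
          refine Finset.sum_le_sum fun jj _ => ?_
          have hp : 0 ≤ ∏ e, P.sbpProb m e (jj e) :=
            Finset.prod_nonneg fun e _ => P.sbpaux_prob_nonneg hd hψn hψe hm e _
          have hm1 := P.sbpaux_ball_unit hd hψn hψe hm k
          have hg := P.sbpaux_Gam_unit hd hψn hψe k.1 k.2 (jj k.1)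
          have h2 : (P.Gam k.1 k.2 (jj k.1) - m k) ^ 2 ≤ 1 := by
            rw [sq_le_one_iff_abs_le_one, abs_le]
            constructor <;> linarith [hm1.1, hm1.2, hg.1, hg.2]
          have h3 := mul_le_mul_of_nonneg_left h2 (sq_nonneg a)
          have h4 := mul_le_mul_of_nonneg_right h3 hp
          linarith
      _ = _ := by
          rw [Finset.sum_add_distrib, ← Finset.mul_sum, ← Finset.mul_sum,
            P.sbpaux_joint_sum hs, P.sbpaux_joint_marg hs, ← P.sbpaux_bp_eq hd hψn hψe]
          ring
  have hCS : ∑ k, (m k - x k) * (P.bp m k - x k) ≤ (1 - lam / 2) * ∑ k, (m k - x k) ^ 2 := by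
    have h2 := hcontr m hm x hx
    rw [hfx] at h2
    simp only [l2norm, Pi.sub_apply] at h2
    calc _ ≤ √(∑ k, (m k - x k) ^ 2) * √(∑ k, (P.bp m k - x k) ^ 2) :=
          Real.sum_mul_le_sqrt_mul_sqrt _ _ _
      _ ≤ √(∑ k, (m k - x k) ^ 2) * ((1 - lam / 2) * √(∑ k, (m k - x k) ^ 2)) :=
          mul_le_mul_of_nonneg_left h2 (Real.sqrt_nonneg _)
      _ = (1 - lam / 2) * (√(∑ k, (m k - x k) ^ 2) * √(∑ k, (m k - x k) ^ 2)) := by ring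
      _ = _ := by rw [Real.mul_self_sqrt (Finset.sum_nonneg fun _ _ => sq_nonneg _)]
  simp only [Finset.sum_mul]
  rw [Finset.sum_comm]
  calc _ ≤ ∑ k, ((m k - x k) ^ 2 + 2 * a * ((m k - x k) * (P.bp m k - m k)) + a ^ 2) :=
        Finset.sum_le_sum fun k _ => h1 k
    _ = ∑ k, ((1 - 2 * a) * (m k - x k) ^ 2 + 2 * a * ((m k - x k) * (P.bp m k - x k)) + a ^ 2) :=
        Finset.sum_congr rfl fun k _ => by ring
    _ = (1 - 2 * a) * (∑ k, (m k - x k) ^ 2) + 2 * a * (∑ k, (m k - x k) * (P.bp m k - x k))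
        + (Fintype.card (P.DirEdge × Fin P.d) : ℝ) * a ^ 2 := by
        rw [Finset.sum_add_distrib, Finset.sum_add_distrib, ← Finset.mul_sum, ← Finset.mul_sum]
        simp
    _ ≤ _ := by
        have := mul_le_mul_of_nonneg_left hCS (by positivity : 0 ≤ 2 * a)
        linarith

end GM

/-- If the BP update `F` is a contraction on `B` with constant `1 − λ/2`
for some `0 < λ < 2`, then `F` has a unique fixed point `m*` in `B`, and the SBP sequence
with positive step sizes satisfying `∑ α_t = ∞` and `∑ α_t² < ∞` converges a.s. to `m*`. -/
theorem sbp_general_converges_almost_surely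
    {V : Type*} [Fintype V] [DecidableEq V] (P : GM V)
    (hd : 0 < P.d)
    (hψn : ∀ u j, 0 < P.ψn u j)
    (hψe : ∀ u v i j, 0 < P.ψe u v i j)
    (hψsymm : ∀ u v i j, P.ψe u v i j = P.ψe v u j i)
    (lam : ℝ) (hlam0 : 0 < lam) (hlam2 : lam < 2)
    (hcontr : ∀ m ∈ P.ball, ∀ m' ∈ P.ball,
      l2norm (P.bp m - P.bp m') ≤ (1 - lam / 2) * l2norm (m - m'))
    {Ω : Type*} {mΩ : MeasurableSpace Ω} (μ : Measure Ω) [IsProbabilityMeasure μ]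
    (ℱ : Filtration ℕ mΩ) (m0 : P.Msg) (hm0 : m0 ∈ P.ball)
    (α : ℕ → ℝ) (hα : ∀ t, α t ∈ Set.Ioo (0 : ℝ) 1)
    (hαdiv : Tendsto (fun n => ∑ t ∈ Finset.range n, α t) atTop atTop)
    (hαsq : Summable fun t => (α t) ^ 2)
    (M : ℕ → Ω → P.Msg) (J : ℕ → Ω → P.DirEdge → Fin P.d)
    (hsbp : P.IsSBP μ ℱ α m0 M J) :
    ∃ mstar ∈ P.ball, P.bp mstar = mstar ∧
      (∀ m' ∈ P.ball, P.bp m' = m' → m' = mstar) ∧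
      ∀ᵐ ω ∂μ, Tendsto (fun t => M t ω) atTop (nhds mstar) := by
  obtain ⟨x, hx, hfx⟩ := P.sbpaux_fixed hd hψn hψe lam hlam0 hlam2 hcontr m0 hm0
  have l2zero : ∀ y : P.Msg, (∑ k, (y k - x k) ^ 2) = 0 → y = x := by
    intro y hy
    rw [Finset.sum_eq_zero_iff_of_nonneg (fun _ _ => sq_nonneg _)] at hy
    funext k
    have := hy k (mem_univ k)
    exact sub_eq_zero.1 (pow_eq_zero_iff (two_ne_zero) |>.1 this)
  refine ⟨x, hx, hfx, ?_, ?_⟩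
  · intro m' hm' hf'
    have h := hcontr m' hm' x hx
    rw [hf', hfx] at h
    have h0 : 0 ≤ l2norm (m' - x) := Real.sqrt_nonneg _
    have h1 : l2norm (m' - x) = 0 := by nlinarith
    apply l2zero
    unfold l2norm at h1
    rwa [Real.sqrt_eq_zero (Finset.sum_nonneg fun _ _ => sq_nonneg _)] at h1
  obtain ⟨hM0, hMm, hJm, hstep, hcond⟩ := hsbp
  have hball : ∀ t ω, M t ω ∈ P.ball := by
    intro t ω
    induction t with
    | zero => rw [hM0]; exact hm0
    | succ t ih => exact P.sbpaux_step_mem hd hψn hψe ih (hα t) (J (t+1) ω) (hstep t ω)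
  have hbound : ∀ y ∈ P.ball, ∑ k, (y k - x k) ^ 2 ≤ (Fintype.card (P.DirEdge × Fin P.d) : ℝ) := by
    intro y hy
    calc _ ≤ ∑ k : P.DirEdge × Fin P.d, (1:ℝ) := by
          refine Finset.sum_le_sum fun k _ => ?_
          have h1 := P.sbpaux_ball_unit hd hψn hψe hy k
          have h2 := P.sbpaux_ball_unit hd hψn hψe hx k
          rw [sq_le_one_iff_abs_le_one, abs_le]
          constructor <;> linarith [h1.1, h1.2, h2.1, h2.2]
      _ = _ := by simp
  have hMk : ∀ t k, Measurable[ℱ t] (fun ω => M t ω k) := fun t k =>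
    (measurable_pi_apply k).comp (hMm t)
  have hX : ∀ᵐ ω ∂μ, Tendsto (fun t => ∑ k, (M t ω k - x k) ^ 2) atTop (nhds 0) := by
    refine sbpaux_rs μ ℱ (fun t ω => ∑ k, (M t ω k - x k) ^ 2) ?_
      (Fintype.card (P.DirEdge × Fin P.d)) (fun t ω => Finset.sum_nonneg fun _ _ => sq_nonneg _)
      (fun t ω => hbound _ (hball t ω)) α (fun t => (hα t).1) hαdiv hαsq lam
      (Fintype.card (P.DirEdge × Fin P.d)) hlam0 (Nat.cast_nonneg _) ?_
    · intro t
      refine Measurable.stronglyMeasurable ?_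
      exact Finset.measurable_fun_sum _ fun k _ => ((hMk t k).sub_const _).pow_const 2
    · intro t
      let g : (P.DirEdge → Fin P.d) → Ω → ℝ := fun jj ω => ∑ k : P.DirEdge × Fin P.d,
        ((1 - α t) * M t ω k + α t * P.Gam k.1 k.2 (jj k.1) - x k) ^ 2
      let I : (P.DirEdge → Fin P.d) → Ω → ℝ :=
        fun jj ω => if ∀ e, J (t+1) ω e = jj e then (1:ℝ) else 0
      have hgm : ∀ jj, StronglyMeasurable[ℱ t] (g jj) := by
        intro jj
        refine Measurable.stronglyMeasurable ?_
        exact Finset.measurable_fun_sum _ fun k _ =>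
          ((((hMk t k).const_mul _).add_const _).sub_const _).pow_const 2
      have hgb : ∀ jj ω, ‖g jj ω‖ ≤ (Fintype.card (P.DirEdge × Fin P.d) : ℝ) := by
        intro jj ω
        rw [Real.norm_of_nonneg (Finset.sum_nonneg fun _ _ => sq_nonneg _)]
        exact hbound (fun k => (1 - α t) * M t ω k + α t * P.Gam k.1 k.2 (jj k.1))
          (P.sbpaux_step_mem hd hψn hψe (hball t ω) (hα t) jj fun e i => rfl)
      have hIm : ∀ jj, Measurable (I jj) := by
        intro jj
        refine Measurable.ite ?_ measurable_const measurable_const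
        have hJ : Measurable (J (t+1)) := (hJm t).mono (ℱ.le _) le_rfl
        have : {ω | ∀ e, J (t+1) ω e = jj e} = J (t+1) ⁻¹' {jj} := by
          ext ω
          simp [funext_iff]
        rw [this]
        exact hJ (measurableSet_singleton jj)
      have hIi : ∀ jj, Integrable (I jj) μ := fun jj =>
        Integrable.of_bound (hIm jj).aestronglyMeasurable 1 (ae_of_all _ fun ω => by
          simp only [I]; split_ifs <;> simp)
      have hgi : ∀ jj, Integrable (g jj * I jj) μ := fun jj =>
        (hIi jj).bdd_mul ((hgm jj).mono (ℱ.le t)).aestronglyMeasurable (ae_of_all _ (hgb jj))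
      have hXeq : (fun ω => ∑ k, (M (t+1) ω k - x k) ^ 2) = ∑ jj, g jj * I jj := by
        funext ω
        rw [Finset.sum_apply, Finset.sum_eq_single (J (t+1) ω)]
        · simp only [g, I, Pi.mul_apply, implies_true, if_true, mul_one]
          refine Finset.sum_congr rfl fun k _ => ?_
          rw [← hstep t ω k.1 k.2]
        · intro jj _ hne
          have : ¬ ∀ e, J (t+1) ω e = jj e := fun h => hne (funext h).symm
          simp only [I, Pi.mul_apply, if_neg this, mul_zero]
        · simp
      have h1 := condExp_finsetSum (μ := μ) (s := univ) (fun jj _ => hgi jj) (ℱ t)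
      have h2 : ∀ᵐ ω ∂μ, ∀ jj, (μ[g jj * I jj | ℱ t]) ω =
          g jj ω * ∏ e : P.DirEdge, P.sbpProb (M t ω) e (jj e) := by
        rw [ae_all_iff]
        intro jj
        filter_upwards [condExp_mul_of_stronglyMeasurable_left (hgm jj) (hgi jj) (hIi jj),
          hcond t jj] with ω ha hb
        rw [ha, Pi.mul_apply]
        congr 1
      rw [hXeq]
      filter_upwards [h1, h2] with ω h1 h2
      rw [h1, Finset.sum_apply, Finset.sum_congr rfl fun jj _ => h2 jj]
      exact P.sbpaux_drift hd hψn hψe lam hcontr x hx hfx (M t ω) (hball t ω) (α t) (hα t).1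
  filter_upwards [hX] with ω hω
  rw [tendsto_pi_nhds]
  intro k
  have h1 : Tendsto (fun t => (M t ω k - x k) ^ 2) atTop (nhds 0) :=
    squeeze_zero (fun _ => sq_nonneg _) (fun t => Finset.single_le_sum
      (f := fun k => (M t ω k - x k) ^ 2) (fun _ _ => sq_nonneg _) (mem_univ k)) hω
  have h2 := h1.sqrt
  simp only [Real.sqrt_sq_eq_abs, Real.sqrt_zero] at h2
  exact tendsto_sub_nhds_zero_iff.1 ((tendsto_zero_iff_abs_tendsto_zero _).2 h2)
end

section
/- Consider a Potts model: a pairwise Markov random field whose edge potentials are ψ_{uv}(i,j) = 1 if i = j and ψ_{uv}(i,j) = ε if i ≠ j, for a fixed parameter ε ∈ (0,1], with arbitrary node potentials ψ_u: X → (0,∞). Then the BP update function F is Lipschitz on B with respect to the Euclidean norm with constant at most L ≤ 4(1 − ε)(1 + (d−1)ε) · max_{u∈V} { ((deg(u) − 1)²/ε^{2·deg(u)}) · (max_{j∈X} ψ_u(j)/∑_{ℓ∈X} ψ_u(ℓ))² }, where deg(u) is the degree of node u in G. -/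
open Finset MeasureTheory Filter

lemma aux_prod {ι : Type*} (s : Finset ι) (f g : ι → ℝ)
    (hf : ∀ i ∈ s, 0 ≤ f i ∧ f i ≤ 1) (hg : ∀ i ∈ s, 0 ≤ g i ∧ g i ≤ 1) :
    |∏ i ∈ s, f i - ∏ i ∈ s, g i| ≤ ∑ i ∈ s, |f i - g i| := by
  classical
  induction s using Finset.induction_on with
  | empty => simp
  | insert a s ha ih =>
    rw [Finset.prod_insert ha, Finset.prod_insert ha, Finset.sum_insert ha]
    have ih' := ih (fun i hi => hf i (Finset.mem_insert_of_mem hi))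
      (fun i hi => hg i (Finset.mem_insert_of_mem hi))
    have h1 := hf a (Finset.mem_insert_self a s)
    have hP0 : 0 ≤ ∏ i ∈ s, g i :=
      Finset.prod_nonneg (fun i hi => (hg i (Finset.mem_insert_of_mem hi)).1)
    have hP1 : ∏ i ∈ s, g i ≤ 1 :=
      Finset.prod_le_one (fun i hi => (hg i (Finset.mem_insert_of_mem hi)).1)
        (fun i hi => (hg i (Finset.mem_insert_of_mem hi)).2)
    have e : f a * ∏ i ∈ s, f i - g a * ∏ i ∈ s, g i
        = f a * (∏ i ∈ s, f i - ∏ i ∈ s, g i) + (f a - g a) * ∏ i ∈ s, g i := by ring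
    rw [e]
    refine (abs_add_le _ _).trans ?_
    rw [abs_mul, abs_mul, abs_of_nonneg h1.1, abs_of_nonneg hP0]
    nlinarith [abs_nonneg (∏ i ∈ s, f i - ∏ i ∈ s, g i), abs_nonneg (f a - g a)]

lemma aux_prod_sq {ι : Type*} (s : Finset ι) (f g : ι → ℝ)
    (hf : ∀ i ∈ s, 0 ≤ f i ∧ f i ≤ 1) (hg : ∀ i ∈ s, 0 ≤ g i ∧ g i ≤ 1) :
    (∏ i ∈ s, f i - ∏ i ∈ s, g i) ^ 2 ≤ (s.card : ℝ) * ∑ i ∈ s, (f i - g i) ^ 2 := by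
  have h := aux_prod s f g hf hg
  calc (∏ i ∈ s, f i - ∏ i ∈ s, g i) ^ 2 = |∏ i ∈ s, f i - ∏ i ∈ s, g i| ^ 2 := (sq_abs _).symm
    _ ≤ (∑ i ∈ s, |f i - g i|) ^ 2 := by gcongr
    _ ≤ (s.card : ℝ) * ∑ i ∈ s, |f i - g i| ^ 2 := sq_sum_le_card_mul_sum_sq
    _ = _ := by simp only [sq_abs]

lemma aux_prob {d : ℕ} (hd : 0 < d) (ψ M M' : Fin d → ℝ) (c q : ℝ) (hψ : ∀ j, 0 < ψ j)
    (hc : 0 < c) (hc1 : c ≤ 1) (hM : ∀ j, c ≤ M j) (hM' : ∀ j, c ≤ M' j)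
    (hM1 : ∀ j, M' j ≤ 1)
    (hq : ∀ j, ψ j ≤ q * ∑ l, ψ l) :
    ∑ i, (ψ i * M i / (∑ l, ψ l * M l) - ψ i * M' i / (∑ l, ψ l * M' l)) ^ 2
      ≤ 4 * q ^ 2 / c ^ 4 * ∑ i, (M i - M' i) ^ 2 := by
  have : Nonempty (Fin d) := ⟨⟨0, hd⟩⟩
  set T := ∑ l, ψ l with hT
  have hT0 : 0 < T := Finset.sum_pos (fun j _ => hψ j) Finset.univ_nonempty
  have hq0 : 0 < q := by
    have := (hψ ⟨0, hd⟩).trans_le (hq ⟨0, hd⟩)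
    exact pos_of_mul_pos_left this hT0.le
  set A := ∑ l, ψ l * M l with hA
  set A' := ∑ l, ψ l * M' l with hA'
  have hAc : c * T ≤ A := by
    rw [hT, hA, Finset.mul_sum]
    exact Finset.sum_le_sum (fun j _ => by nlinarith [hψ j, hM j])
  have hAc' : c * T ≤ A' := by
    rw [hT, hA', Finset.mul_sum]
    exact Finset.sum_le_sum (fun j _ => by nlinarith [hψ j, hM' j])
  have hcT : 0 < c * T := by positivity
  have hA0 : 0 < A := hcT.trans_le hAc
  have hA0' : 0 < A' := hcT.trans_le hAc'
  set X := ∑ i, (M i - M' i) ^ 2 with hX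
  have hX0 : 0 ≤ X := Finset.sum_nonneg (fun i _ => sq_nonneg _)
  set R := ∑ j, ψ j * (M j - M' j) with hR
  have hRA : R = A - A' := by
    rw [hR, hA, hA', ← Finset.sum_sub_distrib]
    exact Finset.sum_congr rfl (fun j _ => by ring)
  set p := fun i => ψ i * M' i / A' with hp
  have hp1 : ∑ i, p i = 1 := by
    simp only [hp]
    rw [← Finset.sum_div, ← hA', div_self hA0'.ne']
  have hp0 : ∀ i, 0 ≤ p i := fun i =>
    div_nonneg (mul_nonneg (hψ i).le (hc.le.trans (hM' i))) hA0'.le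
  have hpq : ∀ i, p i ≤ q / c := by
    intro i
    simp only [hp]
    rw [div_le_div_iff₀ hA0' hc]
    have h1 : ψ i * M' i ≤ q * T := by nlinarith [hψ i, hM1 i, hq i]
    calc ψ i * M' i * c ≤ q * T * c := by gcongr
      _ = q * (c * T) := by ring
      _ ≤ q * A' := by gcongr
  have hpsq : ∑ i, p i ^ 2 ≤ q / c := by
    calc ∑ i, p i ^ 2 ≤ ∑ i, q / c * p i :=
          Finset.sum_le_sum (fun i _ => by nlinarith [hp0 i, hpq i])
      _ = q / c := by rw [← Finset.mul_sum, hp1, mul_one]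
  have hψsq : ∑ i, ψ i ^ 2 ≤ q * T * T := by
    calc ∑ i, ψ i ^ 2 ≤ ∑ i, q * T * ψ i :=
          Finset.sum_le_sum (fun i _ => by nlinarith [hψ i, hq i])
      _ = q * T * T := by rw [← Finset.mul_sum, ← hT]
  have hR2 : R ^ 2 ≤ q * T * T * X := by
    calc R ^ 2 ≤ (∑ i, ψ i ^ 2) * X := Finset.sum_mul_sq_le_sq_mul_sq _ _ _
      _ ≤ _ := by gcongr
  have hD2 : ∑ i, (ψ i * (M i - M' i)) ^ 2 ≤ (q * T) ^ 2 * X := by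
    rw [hX, Finset.mul_sum]
    refine Finset.sum_le_sum (fun i _ => ?_)
    rw [mul_pow]
    have := hψ i
    have := hq i
    gcongr
  have hterm : ∀ i, (ψ i * M i / A - ψ i * M' i / A') ^ 2
      ≤ 2 / A ^ 2 * ((ψ i * (M i - M' i)) ^ 2 + p i ^ 2 * R ^ 2) := by
    intro i
    have e : ψ i * M i / A - ψ i * M' i / A' = (ψ i * (M i - M' i) - p i * R) / A := by
      rw [hRA]
      simp only [hp]
      field_simp
      ring
    rw [e, div_pow, div_mul_eq_mul_div (2 : ℝ)]
    refine div_le_div_of_nonneg_right ?_ (sq_nonneg A)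
    nlinarith [sq_nonneg (ψ i * (M i - M' i) + p i * R)]
  calc ∑ i, (ψ i * M i / A - ψ i * M' i / A') ^ 2
      ≤ ∑ i, 2 / A ^ 2 * ((ψ i * (M i - M' i)) ^ 2 + p i ^ 2 * R ^ 2) :=
        Finset.sum_le_sum (fun i _ => hterm i)
    _ = 2 / A ^ 2 * (∑ i, (ψ i * (M i - M' i)) ^ 2 + (∑ i, p i ^ 2) * R ^ 2) := by
        rw [← Finset.mul_sum, Finset.sum_add_distrib, Finset.sum_mul]
    _ ≤ 2 / (c * T) ^ 2 * ((q * T) ^ 2 * X + q / c * (q * T * T * X)) := by gcongr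
    _ = 2 * q ^ 2 * X / c ^ 2 + 2 * q ^ 2 * X / c ^ 3 := by field_simp
    _ ≤ 2 * q ^ 2 * X / c ^ 4 + 2 * q ^ 2 * X / c ^ 4 := by
        have h2 : c ^ 4 ≤ c ^ 2 := pow_le_pow_of_le_one hc.le hc1 (by norm_num)
        have h3 : c ^ 4 ≤ c ^ 3 := pow_le_pow_of_le_one hc.le hc1 (by norm_num)
        gcongr
    _ = 4 * q ^ 2 / c ^ 4 * X := by ring

lemma aux_node (ε q S : ℝ) (n : ℕ) (hε0 : 0 < ε) (hε1 : ε ≤ 1) (hq : 0 < q)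
    (hS : 0 < S) (hSq : ε ≤ S * q) :
    (1 - ε) ^ 2 * (4 * q ^ 2 / (ε ^ n) ^ 4) * n * n ≤
      (4 * (1 - ε) * S * ((((n + 1 : ℕ) : ℝ) - 1) ^ 2 / ε ^ (2 * (n + 1)) * q ^ 2)) ^ 2 := by
  have e : (1 - ε) ^ 2 * (4 * q ^ 2 / (ε ^ n) ^ 4) * n * n =
      (2 * (1 - ε) * q * n / (ε ^ n) ^ 2) ^ 2 := by
    field_simp
    ring
  rw [e]
  have h1 : 0 ≤ 1 - ε := by linarith
  refine pow_le_pow_left₀ (by positivity) ?_ 2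
  have e2 : 4 * (1 - ε) * S * ((((n + 1 : ℕ) : ℝ) - 1) ^ 2 / ε ^ (2 * (n + 1)) * q ^ 2)
     = (2 * (1 - ε) * q * n / (ε ^ n) ^ 2) * (2 * (S * q) * n / ε ^ 2) := by
    push_cast
    rw [show ε ^ (2 * (n + 1)) = (ε ^ n) ^ 2 * ε ^ 2 by ring]
    field_simp
    ring
  rw [e2]
  rcases Nat.eq_zero_or_pos n with rfl | hn
  · simp
  · refine le_mul_of_one_le_right (by positivity) ?_
    rw [one_le_div (by positivity)]
    have hn' : (1 : ℝ) ≤ n := by exact_mod_cast hn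
    have : S * q * 1 ≤ S * q * n := by gcongr
    nlinarith

lemma aux_count {V : Type*} [Fintype V] [DecidableEq V] (P : GM V)
    (K : V → ℝ) (D : P.DirEdge → ℝ) (C : ℝ) (hD : ∀ e, 0 ≤ D e)
    (hK : ∀ e : P.DirEdge, K e.1.2 * ((P.G.degree e.1.2 - 1 : ℕ) : ℝ) ≤ C) :
    ∑ e : P.DirEdge, K e.1.1 *
      ∑ w ∈ ((P.G.neighborFinset e.1.1).erase e.1.2).attach, D (P.revEdge e w)
      ≤ C * ∑ e, D e := by
  have h1 : ∀ e : P.DirEdge,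
      ∑ w ∈ ((P.G.neighborFinset e.1.1).erase e.1.2).attach, D (P.revEdge e w)
      = ∑ e' : P.DirEdge, if e'.1.2 = e.1.1 ∧ e'.1.1 ≠ e.1.2 then D e' else 0 := by
    intro e
    rw [← Finset.sum_filter]
    refine Finset.sum_bij (fun w _ => P.revEdge e w) ?_ ?_ ?_ ?_
    · intro w _
      simp only [Finset.mem_filter, Finset.mem_univ, true_and]
      exact ⟨rfl, Finset.ne_of_mem_erase w.2⟩
    · intro a _ b _ hab
      apply Subtype.ext
      exact congrArg (fun x : P.DirEdge => x.1.1) hab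
    · intro e' he'
      simp only [Finset.mem_filter, Finset.mem_univ, true_and] at he'
      refine ⟨⟨e'.1.1, ?_⟩, Finset.mem_attach _ _, ?_⟩
      · rw [Finset.mem_erase, SimpleGraph.mem_neighborFinset, ← he'.1]
        exact ⟨he'.2, e'.2.symm⟩
      · apply Subtype.ext
        exact Prod.ext rfl he'.1.symm
    · intro w _
      rfl
  have h2 : ∀ e' : P.DirEdge,
      (Finset.univ.filter (fun e : P.DirEdge => e'.1.2 = e.1.1 ∧ e'.1.1 ≠ e.1.2)).card
        = P.G.degree e'.1.2 - 1 := by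
    intro e'
    have hm : e'.1.1 ∈ P.G.neighborFinset e'.1.2 := by
      rw [SimpleGraph.mem_neighborFinset]; exact e'.2.symm
    rw [← SimpleGraph.card_neighborFinset_eq_degree, ← Finset.card_erase_of_mem hm]
    refine Finset.card_bij (fun e _ => e.1.2) ?_ ?_ ?_
    · intro e he
      simp only [Finset.mem_filter, Finset.mem_univ, true_and] at he
      rw [Finset.mem_erase, SimpleGraph.mem_neighborFinset, he.1]
      exact ⟨he.2.symm, e.2⟩
    · intro a ha b hb hab
      simp only [Finset.mem_filter, Finset.mem_univ, true_and] at ha hb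
      exact Subtype.ext (Prod.ext (ha.1.symm.trans hb.1) hab)
    · intro v hv
      rw [Finset.mem_erase, SimpleGraph.mem_neighborFinset] at hv
      refine ⟨⟨(e'.1.2, v), hv.2⟩, ?_, rfl⟩
      simp only [Finset.mem_filter, Finset.mem_univ, true_and]
      exact hv.1.symm
  simp only [h1, Finset.mul_sum]
  rw [Finset.sum_comm]
  refine Finset.sum_le_sum (fun e' _ => ?_)
  calc ∑ e : P.DirEdge, K e.1.1 * (if e'.1.2 = e.1.1 ∧ e'.1.1 ≠ e.1.2 then D e' else 0)
      = ∑ e : P.DirEdge, (if e'.1.2 = e.1.1 ∧ e'.1.1 ≠ e.1.2 then K e'.1.2 * D e' else 0) := by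
        refine Finset.sum_congr rfl (fun e _ => ?_)
        split_ifs with h
        · rw [h.1]
        · simp
    _ = K e'.1.2 * ((P.G.degree e'.1.2 - 1 : ℕ) : ℝ) * D e' := by
        rw [← Finset.sum_filter, Finset.sum_const, h2, nsmul_eq_mul]
        ring
    _ ≤ C * D e' := mul_le_mul_of_nonneg_right (hK e') (hD e')

lemma aux_colsum {d : ℕ} (ε : ℝ) (j : Fin d) :
    ∑ i : Fin d, (if i = j then (1 : ℝ) else ε) = 1 + ((d : ℝ) - 1) * ε := by
  have : ∀ i : Fin d, (if i = j then (1 : ℝ) else ε) = ε + (if i = j then 1 - ε else 0) := by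
    intro i; split_ifs <;> ring
  simp only [this, Finset.sum_add_distrib, Finset.sum_ite_eq', Finset.mem_univ, if_true,
    Finset.sum_const, Finset.card_univ, Fintype.card_fin, nsmul_eq_mul]
  ring

lemma aux_ball {V : Type*} [Fintype V] [DecidableEq V] (P : GM V)
    (hd : 0 < P.d) (hψn : ∀ u j, 0 < P.ψn u j)
    (ε : ℝ) (hε0 : 0 < ε) (hε1 : ε ≤ 1)
    (hpotts : ∀ u v, P.G.Adj u v → ∀ i j, P.ψe u v i j = if i = j then 1 else ε)
    (S : ℝ) (hS : S = 1 + ((P.d : ℝ) - 1) * ε) (hS0 : 0 < S)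
    (m : P.Msg) (hm : m ∈ P.ball) (e : P.DirEdge) (i : Fin P.d) :
    ε ≤ S * m (e, i) ∧ S * m (e, i) ≤ 1 := by
  have : Nonempty (Fin P.d) := ⟨⟨0, hd⟩⟩
  have hG : ∀ j, P.Gam e i j = (if i = j then 1 else ε) / S := by
    intro j
    unfold GM.Gam GM.bmass
    simp only [hpotts _ _ e.2, aux_colsum, ← hS]
    have := (hψn e.1.1 j).ne'
    field_simp
  have h := (hm e).2 i
  have hb : ε / S ≤ P.beta0 e i := by
    refine le_ciInf (fun j => ?_)
    rw [hG]
    gcongr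
    split_ifs <;> linarith
  have hu : P.mu0 e i ≤ 1 / S := by
    refine ciSup_le (fun j => ?_)
    rw [hG]
    gcongr
    split_ifs <;> linarith
  have h1 := hb.trans h.1
  have h2 := h.2.trans hu
  rw [div_le_iff₀ hS0] at h1
  rw [le_div_iff₀ hS0] at h2
  constructor <;> linarith

lemma aux_bp {V : Type*} [Fintype V] [DecidableEq V] (P : GM V)
    (ε : ℝ)
    (hpotts : ∀ u v, P.G.Adj u v → ∀ i j, P.ψe u v i j = if i = j then 1 else ε)
    (S : ℝ) (hS : S = 1 + ((P.d : ℝ) - 1) * ε) (hS0 : 0 < S)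
    (m : P.Msg) (e : P.DirEdge) (i : Fin P.d) (t : ℝ) (ht : t ≠ 0)
    (hA : ∑ j, P.ψn e.1.1 j * P.Mprod m e j ≠ 0) :
    P.bp m (e, i) = ε / S + (1 - ε) / S *
      (P.ψn e.1.1 i * (t * P.Mprod m e i) / ∑ j, P.ψn e.1.1 j * (t * P.Mprod m e j)) := by
  unfold GM.bp
  simp only [hpotts _ _ e.2]
  have h1 : ∑ i : Fin P.d, ∑ j : Fin P.d,
      (if i = j then (1 : ℝ) else ε) * P.ψn e.1.1 j * P.Mprod m e j
      = S * ∑ j, P.ψn e.1.1 j * P.Mprod m e j := by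
    rw [Finset.sum_comm, Finset.mul_sum]
    refine Finset.sum_congr rfl (fun j _ => ?_)
    simp only [mul_assoc]
    rw [← Finset.sum_mul, aux_colsum, ← hS]
  have h2 : ∑ j : Fin P.d, (if i = j then (1 : ℝ) else ε) * P.ψn e.1.1 j * P.Mprod m e j
      = ε * (∑ j, P.ψn e.1.1 j * P.Mprod m e j) + (1 - ε) * (P.ψn e.1.1 i * P.Mprod m e i) := by
    have : ∀ j : Fin P.d, (if i = j then (1 : ℝ) else ε) * P.ψn e.1.1 j * P.Mprod m e j
      = ε * (P.ψn e.1.1 j * P.Mprod m e j)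
        + if i = j then (1 - ε) * (P.ψn e.1.1 j * P.Mprod m e j) else 0 := by
      intro j; split_ifs <;> ring
    simp only [this, Finset.sum_add_distrib, Finset.sum_ite_eq, Finset.mem_univ, if_true,
      Finset.mul_sum]
  have h3 : ∑ j, P.ψn e.1.1 j * (t * P.Mprod m e j)
      = t * ∑ j, P.ψn e.1.1 j * P.Mprod m e j := by
    rw [Finset.mul_sum]
    exact Finset.sum_congr rfl (fun j _ => by ring)
  rw [h1, h2, h3]
  field_simp

lemma aux_edge {V : Type*} [Fintype V] [DecidableEq V] (P : GM V)
    (hd : 0 < P.d) (hψn : ∀ u j, 0 < P.ψn u j)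
    (ε : ℝ) (hε0 : 0 < ε) (hε1 : ε ≤ 1)
    (hpotts : ∀ u v, P.G.Adj u v → ∀ i j, P.ψe u v i j = if i = j then 1 else ε)
    (S : ℝ) (hS : S = 1 + ((P.d : ℝ) - 1) * ε) (hS0 : 0 < S)
    (m m' : P.Msg) (hm : m ∈ P.ball) (hm' : m' ∈ P.ball) (e : P.DirEdge) (q : ℝ)
    (hq : ∀ j, P.ψn e.1.1 j ≤ q * ∑ l, P.ψn e.1.1 l) (n : ℕ)
    (hn : ((P.G.neighborFinset e.1.1).erase e.1.2).card = n) :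
    ∑ i, (P.bp m (e, i) - P.bp m' (e, i)) ^ 2 ≤
      (1 - ε) ^ 2 * (4 * q ^ 2 / (ε ^ n) ^ 4) * n *
        ∑ w ∈ ((P.G.neighborFinset e.1.1).erase e.1.2).attach,
          ∑ i, (m (P.revEdge e w, i) - m' (P.revEdge e w, i)) ^ 2 := by
  have : Nonempty (Fin P.d) := ⟨⟨0, hd⟩⟩
  set s := ((P.G.neighborFinset e.1.1).erase e.1.2).attach with hs
  have hsc : s.card = n := by rw [hs, Finset.card_attach, hn]
  have hB := aux_ball P hd hψn ε hε0 hε1 hpotts S hS hS0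
  have hMt : ∀ (x : P.Msg) (j), S ^ n * P.Mprod x e j = ∏ w ∈ s, (S * x (P.revEdge e w, j)) := by
    intro x j
    rw [Finset.prod_mul_distrib, Finset.prod_const, hsc]
    rfl
  have hlo : ∀ x ∈ P.ball, ∀ j, ε ^ n ≤ S ^ n * P.Mprod x e j := by
    intro x hx j
    rw [hMt, ← hsc, ← Finset.prod_const]
    exact Finset.prod_le_prod (fun _ _ => hε0.le) (fun w _ => (hB x hx _ j).1)
  have hhi : ∀ x ∈ P.ball, ∀ j, S ^ n * P.Mprod x e j ≤ 1 := by
    intro x hx j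
    rw [hMt]
    exact Finset.prod_le_one (fun w _ => hε0.le.trans (hB x hx _ j).1)
      (fun w _ => (hB x hx _ j).2)
  have hA : ∀ x ∈ P.ball, ∑ j, P.ψn e.1.1 j * P.Mprod x e j ≠ 0 := by
    intro x hx
    refine (Finset.sum_pos (fun j _ => mul_pos (hψn _ j) ?_) Finset.univ_nonempty).ne'
    have : 0 < S ^ n * P.Mprod x e j := (pow_pos hε0 n).trans_le (hlo x hx j)
    exact pos_of_mul_pos_right this (pow_pos hS0 n).le
  have hSn : S ^ n ≠ 0 := (pow_pos hS0 n).ne'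
  have key := aux_prob hd (P.ψn e.1.1) (fun j => S ^ n * P.Mprod m e j)
    (fun j => S ^ n * P.Mprod m' e j) (ε ^ n) q (hψn _) (pow_pos hε0 n)
    (pow_le_one₀ hε0.le hε1) (hlo m hm) (hlo m' hm') (hhi m' hm') hq
  have hx : ∑ j, (S ^ n * P.Mprod m e j - S ^ n * P.Mprod m' e j) ^ 2
      ≤ n * S ^ 2 * ∑ w ∈ s, ∑ i, (m (P.revEdge e w, i) - m' (P.revEdge e w, i)) ^ 2 := by
    rw [Finset.sum_comm, Finset.mul_sum]
    refine Finset.sum_le_sum (fun j _ => ?_)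
    rw [hMt, hMt]
    refine (aux_prod_sq s _ _ (fun w _ => ⟨hε0.le.trans (hB m hm _ j).1, (hB m hm _ j).2⟩)
      (fun w _ => ⟨hε0.le.trans (hB m' hm' _ j).1, (hB m' hm' _ j).2⟩)).trans_eq ?_
    rw [hsc, mul_assoc, Finset.mul_sum (a := S ^ 2)]
    congr 1
    exact Finset.sum_congr rfl (fun w _ => by ring)
  have e1 : ∑ i, (P.bp m (e, i) - P.bp m' (e, i)) ^ 2 = ((1 - ε) / S) ^ 2 *
      ∑ i, (P.ψn e.1.1 i * (S ^ n * P.Mprod m e i)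
          / (∑ l, P.ψn e.1.1 l * (S ^ n * P.Mprod m e l))
        - P.ψn e.1.1 i * (S ^ n * P.Mprod m' e i)
          / (∑ l, P.ψn e.1.1 l * (S ^ n * P.Mprod m' e l))) ^ 2 := by
    rw [Finset.mul_sum]
    refine Finset.sum_congr rfl (fun i _ => ?_)
    rw [aux_bp P ε hpotts S hS hS0 m e i (S ^ n) hSn (hA m hm),
      aux_bp P ε hpotts S hS hS0 m' e i (S ^ n) hSn (hA m' hm')]
    ring
  rw [e1]
  refine (mul_le_mul_of_nonneg_left (key.trans
    (mul_le_mul_of_nonneg_left hx (by positivity))) (sq_nonneg _)).trans_eq ?_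
  field_simp

/-- For the Potts model with parameter `ε ∈ (0,1]` and arbitrary positive node
potentials, the BP update `F` is Lipschitz on `B` with constant at most
`4(1−ε)(1+(d−1)ε) · max_u { ((deg(u)−1)²/ε^{2 deg(u)}) (max_j ψ_u(j)/∑_ℓ ψ_u(ℓ))² }`. -/
theorem potts_bp_lipschitz_bound
    {V : Type*} [Fintype V] [DecidableEq V] [Nonempty V] (P : GM V)
    (hd : 0 < P.d)
    (hψn : ∀ u j, 0 < P.ψn u j)
    (ε : ℝ) (hε0 : 0 < ε) (hε1 : ε ≤ 1)
    (hpotts : ∀ u v, P.G.Adj u v → ∀ i j, P.ψe u v i j = if i = j then 1 else ε) :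
    ∀ m ∈ P.ball, ∀ m' ∈ P.ball,
      l2norm (P.bp m - P.bp m') ≤
        (4 * (1 - ε) * (1 + ((P.d : ℝ) - 1) * ε) *
          ⨆ u : V, ((P.G.degree u : ℝ) - 1) ^ 2 / ε ^ (2 * P.G.degree u) *
            (⨆ j : Fin P.d, P.ψn u j / ∑ ℓ, P.ψn u ℓ) ^ 2) * l2norm (m - m') := by
  intro m hm m' hm'
  have : Nonempty (Fin P.d) := ⟨⟨0, hd⟩⟩
  have hd1 : (1 : ℝ) ≤ P.d := by exact_mod_cast hd
  obtain ⟨S, hS⟩ : ∃ S, S = 1 + ((P.d : ℝ) - 1) * ε := ⟨_, rfl⟩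
  rw [← hS]
  have hS0 : 0 < S := by rw [hS]; nlinarith
  have hSd : ε * P.d ≤ S := by rw [hS]; nlinarith
  set q : V → ℝ := fun u => ⨆ j : Fin P.d, P.ψn u j / ∑ ℓ, P.ψn u ℓ with hqdef
  set B : V → ℝ := fun u => ((P.G.degree u : ℝ) - 1) ^ 2 / ε ^ (2 * P.G.degree u) * q u ^ 2
    with hBdef
  have hε' : 0 ≤ 1 - ε := by linarith
  have hT : ∀ u, 0 < ∑ ℓ, P.ψn u ℓ := fun u =>
    Finset.sum_pos (fun j _ => hψn u j) Finset.univ_nonempty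
  have hq : ∀ u j, P.ψn u j ≤ q u * ∑ ℓ, P.ψn u ℓ := by
    intro u j
    rw [← div_le_iff₀ (hT u)]
    exact le_ciSup (f := fun j => P.ψn u j / ∑ ℓ, P.ψn u ℓ) (Set.finite_range _).bddAbove j
  have hq0 : ∀ u, 0 < q u := fun u =>
    pos_of_mul_pos_left ((hψn u ⟨0, hd⟩).trans_le (hq u ⟨0, hd⟩)) (hT u).le
  have hqd : ∀ u, 1 ≤ P.d * q u := by
    intro u
    have h : ∑ j, P.ψn u j ≤ ∑ j : Fin P.d, q u * ∑ ℓ, P.ψn u ℓ :=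
      Finset.sum_le_sum (fun j _ => hq u j)
    rw [Finset.sum_const, Finset.card_univ, Fintype.card_fin, nsmul_eq_mul, ← mul_assoc] at h
    exact (le_mul_iff_one_le_left (hT u)).1 h
  have hSq : ∀ u, ε ≤ S * q u := by
    intro u
    calc ε = ε * 1 := (mul_one _).symm
      _ ≤ ε * (P.d * q u) := by gcongr; exact hqd u
      _ = ε * P.d * q u := by ring
      _ ≤ S * q u := mul_le_mul_of_nonneg_right hSd (hq0 u).le
  have hB0 : ∀ u, 0 ≤ B u := fun u => by simp only [hBdef]; positivity
  have hBs : ∀ u, B u ≤ ⨆ u, B u := fun u => le_ciSup (Set.finite_range B).bddAbove u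
  set L := 4 * (1 - ε) * S * ⨆ u, B u with hL
  have hL0 : 0 ≤ L := by
    have : 0 ≤ ⨆ u, B u := Real.iSup_nonneg hB0
    positivity
  set K : V → ℝ := fun u => (1 - ε) ^ 2 * (4 * q u ^ 2 / (ε ^ (P.G.degree u - 1)) ^ 4) *
    ((P.G.degree u - 1 : ℕ) : ℝ) with hK
  have hKL : ∀ e : P.DirEdge, K e.1.2 * ((P.G.degree e.1.2 - 1 : ℕ) : ℝ) ≤ L ^ 2 := by
    intro e
    have hdeg : 0 < P.G.degree e.1.2 := by
      rw [SimpleGraph.degree_pos_iff_exists_adj]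
      exact ⟨e.1.1, e.2.symm⟩
    have h := aux_node ε (q e.1.2) S (P.G.degree e.1.2 - 1) hε0 hε1 (hq0 _) hS0 (hSq _)
    rw [Nat.sub_add_cancel hdeg] at h
    refine h.trans (pow_le_pow_left₀ ?_ ?_ 2)
    · have := hB0 e.1.2
      exact mul_nonneg (by positivity) this
    · exact mul_le_mul_of_nonneg_left (hBs e.1.2) (by positivity)
  have hmain : ∑ p, (P.bp m - P.bp m') p ^ 2 ≤ L ^ 2 * ∑ p, (m - m') p ^ 2 := by
    rw [Fintype.sum_prod_type, Fintype.sum_prod_type]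
    refine le_trans (Finset.sum_le_sum (fun e _ => ?_))
      (aux_count P K (fun e => ∑ i, (m (e, i) - m' (e, i)) ^ 2) (L ^ 2)
        (fun e => Finset.sum_nonneg (fun _ _ => sq_nonneg _)) hKL)
    refine aux_edge P hd hψn ε hε0 hε1 hpotts S hS hS0 m m' hm hm' e (q e.1.1) (hq _)
      (P.G.degree e.1.1 - 1) ?_
    rw [Finset.card_erase_of_mem, SimpleGraph.card_neighborFinset_eq_degree]
    rw [SimpleGraph.mem_neighborFinset]
    exact e.2
  unfold l2norm
  calc Real.sqrt (∑ p, (P.bp m - P.bp m') p ^ 2)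
      ≤ Real.sqrt (L ^ 2 * ∑ p, (m - m') p ^ 2) := Real.sqrt_le_sqrt hmain
    _ = L * Real.sqrt (∑ p, (m - m') p ^ 2) := by
        rw [Real.sqrt_mul (sq_nonneg L), Real.sqrt_sq hL0]
end
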